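/- arXiv:1108.2215 — 8 statements merged into one kernel-verified Lean document; each statement's English description precedes it below -/
import Mathlib

section
/- For every prime q and every natural number n, the number N(n) of isomorphism classes of pointed abelian groups (A,c) with |A| = q^n equals the sum over m from 0 to n of p(m)·p(n-m), where p denotes the partition function. In particular N(n) does not depend on the prime q. -/
/-- A pointed abelian group: an abelian group together with a distinguished element. -/
structure PtdAbGroup where
  carrier : Type
  [addCommGroup : AddCommGroup carrier]
  pt : carrier

attribute [instance] PtdAbGroup.addCommGroup

/-- Isomorphism of pointed abelian groups: a group isomorphism carrying the
distinguished element to the distinguished element. -/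
def PtdAbGroup.Iso (P Q : PtdAbGroup) : Prop :=
  ∃ f : P.carrier ≃+ Q.carrier, f P.pt = Q.pt

theorem card_pi_zmod_pow {ι : Type*} [Fintype ι] (q : ℕ) (l : ι → ℕ) :
    Nat.card (∀ i, ZMod (q ^ l i)) = q ^ ∑ i, l i := by
  rw [Nat.card_pi, ← Finset.prod_pow_eq_pow_sum]
  simp

/-- Trivial cyclic factors can be inserted into or removed from a product of cyclic groups. -/
theorem nonempty_pi_zmod_pow_addEquiv {ι κ : Type*} [Fintype ι] [Fintype κ] {q : ℕ} (hq : 0 < q)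
    (l : ι → ℕ) (m : κ → ℕ) (f : ι → κ) (hf : Function.Injective f) (hlm : ∀ i, m (f i) = l i)
    (hm : ∀ k, k ∉ Set.range f → m k = 0) :
    Nonempty ((∀ k, ZMod (q ^ m k)) ≃+ (∀ i, ZMod (q ^ l i))) := by
  let e (i : ι) : ZMod (q ^ m (f i)) ≃+* ZMod (q ^ l i) :=
    ZMod.ringEquivCongr (congrArg (q ^ ·) (hlm i))
  let φ : (∀ k, ZMod (q ^ m k)) →+ (∀ i, ZMod (q ^ l i)) :=
    { toFun := fun x i => e i (x (f i))
      map_zero' := by ext i; simp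
      map_add' := fun x y => by ext i; simp }
  have hinj : Function.Injective φ := by
    intro x y hxy
    ext k
    by_cases hk : k ∈ Set.range f
    · obtain ⟨i, rfl⟩ := hk
      exact (e i).injective (congrFun hxy i)
    · have : Subsingleton (ZMod (q ^ m k)) := by
        rw [hm k hk, pow_zero]
        infer_instance
      exact Subsingleton.elim _ _
  have hsum : ∑ k, m k = ∑ i, l i :=
    (Fintype.sum_of_injective f hf l m hm fun i => (hlm i).symm).symm
  have hcard : Nat.card (∀ k, ZMod (q ^ m k)) = Nat.card (∀ i, ZMod (q ^ l i)) := by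
    rw [card_pi_zmod_pow, card_pi_zmod_pow, hsum]
  have (i : ι) : NeZero (q ^ l i) := ⟨(pow_pos hq _).ne'⟩
  exact ⟨AddEquiv.ofBijective φ ((Nat.bijective_iff_injective_and_card φ).2 ⟨hinj, hcard⟩)⟩

theorem exists_antitone_addEquiv_pi_zmod {q : ℕ} (hq : q.Prime) {n : ℕ} {A : Type*}
    [AddCommGroup A] (hA : Nat.card A = q ^ n) :
    ∃ l : Fin n → ℕ, Antitone l ∧ ∑ i, l i = n ∧ Nonempty (A ≃+ ∀ i, ZMod (q ^ l i)) := by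
  have : Finite A := Nat.finite_of_card_ne_zero (hA ▸ (pow_pos hq.pos n).ne')
  obtain ⟨ι, _, p, hp, e, ⟨φ⟩⟩ := AddCommGroup.equiv_directSum_zmod_of_finite A
  replace φ := φ.trans (DirectSum.addEquivProd _)
  have hprod : ∏ i, p i ^ e i = q ^ n := by
    rw [← hA, Nat.card_congr φ.toEquiv, Nat.card_pi]
    simp
  have hpe (i : ι) : p i ^ e i = q ^ e i := by
    rcases Nat.eq_zero_or_pos (e i) with h | h
    · simp [h]
    · have : p i ∣ q ^ n := hprod ▸ (dvd_pow_self _ h.ne').trans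
        (Finset.dvd_prod_of_mem (fun i => p i ^ e i) (Finset.mem_univ i))
      rw [(Nat.prime_dvd_prime_iff_eq (hp i) hq).1 ((hp i).dvd_of_dvd_pow this)]
  have hsum : ∑ i, e i = n := by
    apply Nat.pow_right_injective hq.two_le
    simp only [← hprod, ← Finset.prod_pow_eq_pow_sum, hpe]
  have hcard : Fintype.card {i // 0 < e i} ≤ Fintype.card (Fin n) := by
    rw [Fintype.card_fin, Fintype.card_subtype, ← hsum, Finset.card_eq_sum_ones,
      Finset.sum_filter]
    exact Finset.sum_le_sum fun i _ => by split_ifs <;> omega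
  obtain ⟨f⟩ := Function.Embedding.nonempty_of_card_le hcard
  let m : Fin n → ℕ := Function.extend f (fun i => e i) 0
  let σ := Tuple.sort (OrderDual.toDual ∘ m)
  obtain ⟨ψ⟩ := nonempty_pi_zmod_pow_addEquiv hq.pos (fun i : {i // 0 < e i} => e i) (m ∘ σ)
    (σ.symm ∘ f) (σ.symm.injective.comp f.injective)
    (fun i => by simp [m, f.injective.extend_apply])
    (fun k hk => by
      refine (Function.extend_apply' (f := f) (fun i => e i) 0 (σ k) ?_).trans rfl
      rintro ⟨i, hi⟩
      exact hk ⟨i, by simp [hi]⟩)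
  obtain ⟨χ⟩ := nonempty_pi_zmod_pow_addEquiv hq.pos (fun i : {i // 0 < e i} => e i) e
    Subtype.val Subtype.val_injective (fun _ => rfl)
    (fun k hk => by simpa using hk)
  let Φ : A ≃+ ∀ i, ZMod (q ^ (m ∘ σ) i) :=
    (φ.trans (AddEquiv.piCongrRight fun i => (ZMod.ringEquivCongr (hpe i)).toAddEquiv)).trans
      (χ.trans ψ.symm)
  refine ⟨m ∘ σ, Tuple.monotone_sort (OrderDual.toDual ∘ m), ?_, ⟨Φ⟩⟩
  apply Nat.pow_right_injective hq.two_le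
  simp only
  rw [← card_pi_zmod_pow, ← hA, Nat.card_congr Φ.toEquiv]

theorem exists_eq_unit_mul_pow {q : ℕ} (hq : q.Prime) (l : ℕ) (c : ZMod (q ^ l)) :
    ∃ b ≤ l, ∃ u : (ZMod (q ^ l))ˣ, u * c = (q : ZMod (q ^ l)) ^ b := by
  have : NeZero (q ^ l) := ⟨(pow_pos hq.pos _).ne'⟩
  by_cases hc : c = 0
  · refine ⟨l, le_rfl, 1, ?_⟩
    rw [hc, mul_zero, ← Nat.cast_pow, ZMod.natCast_self]
  obtain ⟨b, t, ht, h⟩ := Nat.exists_eq_pow_mul_and_not_dvd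
    (mt (ZMod.val_eq_zero c).1 hc) q hq.ne_one
  have htq : t.Coprime (q ^ l) := (((Nat.Prime.coprime_iff_not_dvd hq).2 ht).symm).pow_right l
  have hbl : q ^ b < q ^ l := by
    have := c.val_lt
    have ht0 : 0 < t := Nat.pos_of_ne_zero fun h0 => ht (h0 ▸ dvd_zero q)
    nlinarith [pow_pos hq.pos b]
  refine ⟨b, ((Nat.pow_lt_pow_iff_right hq.one_lt).1 hbl).le, (ZMod.unitOfCoprime t htq)⁻¹, ?_⟩
  rw [Units.inv_mul_eq_iff_eq_mul, ZMod.coe_unitOfCoprime, ← ZMod.natCast_zmod_val c, h]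
  push_cast
  ring

/-- The transvection `x ↦ x + t (x i) eⱼ`. -/
def AddEquiv.piShear {ι : Type*} [DecidableEq ι] {M : ι → Type*} [∀ i, AddCommGroup (M i)]
    {i j : ι} (hij : i ≠ j) (t : M i →+ M j) : (∀ k, M k) ≃+ (∀ k, M k) where
  toFun x := x + Pi.single j (t (x i))
  invFun x := x - Pi.single j (t (x i))
  left_inv x := by simp [Pi.single_eq_of_ne hij]
  right_inv x := by simp [Pi.single_eq_of_ne hij]
  map_add' x y := by
    simp only [Pi.add_apply, map_add, Pi.single_add]
    abel

theorem ZMod.exists_addMonoidHom_apply_eq_mul {a b : ℕ} (z : ZMod b) (hz : (a : ZMod b) * z = 0) :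
    ∃ t : ZMod a →+ ZMod b, ∀ k : ℕ, t k = k * z :=
  ⟨ZMod.lift a ⟨zmultiplesHom _ z, by simpa using hz⟩, fun k => by
    have := ZMod.lift_coe a (⟨zmultiplesHom _ z, by simpa using hz⟩ :
      { f : ℤ →+ ZMod b // f a = 0 }) k
    simpa using this⟩

theorem exists_addEquiv_pow_pred {ι : Type*} [DecidableEq ι] {q : ℕ} {l b : ι → ℕ}
    (hb : ∀ i, b i ≤ l i) {i j : ι} (hij : b i < b j) (hji : l j - b j < l i - b i) :
    ∃ f : (∀ k, ZMod (q ^ l k)) ≃+ (∀ k, ZMod (q ^ l k)),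
      f (fun k => (q : ZMod (q ^ l k)) ^ b k) =
        fun k => (q : ZMod (q ^ l k)) ^ Function.update b j (b j - 1) k := by
  have hne : i ≠ j := by rintro rfl; exact hij.false
  obtain ⟨t, ht⟩ := ZMod.exists_addMonoidHom_apply_eq_mul (a := q ^ l i) (b := q ^ l j)
    ((q : ZMod (q ^ l j)) ^ (b j - 1 - b i) * (1 - q)) (by
      have h : (q : ZMod (q ^ l j)) ^ l j = 0 := by rw [← Nat.cast_pow, ZMod.natCast_self]
      rw [Nat.cast_pow, ← mul_assoc, ← pow_add,
        pow_eq_zero_of_le (by have := hb j; omega) h, zero_mul])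
  refine ⟨AddEquiv.piShear hne t, ?_⟩
  change (fun k => (q : ZMod (q ^ l k)) ^ b k) + Pi.single j (t (q ^ b i)) = _
  ext k
  by_cases hk : k = j
  · subst hk
    have h1 := ht (q ^ b i)
    push_cast at h1
    rw [← mul_assoc, ← pow_add, show b i + (b k - 1 - b i) = b k - 1 by omega] at h1
    simp only [Pi.add_apply, Pi.single_eq_same, Function.update_self, h1]
    obtain ⟨r, hr⟩ : ∃ r, b k = r + 1 := ⟨b k - 1, by omega⟩
    rw [hr, Nat.add_sub_cancel]
    ring
  · simp [hk]

theorem exists_antitone_addEquiv_apply_eq_pow {q : ℕ} (hq : q.Prime) {n : ℕ} {A : Type*}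
    [AddCommGroup A] (hA : Nat.card A = q ^ n) (c : A) :
    ∃ a b : Fin n → ℕ, Antitone a ∧ Antitone b ∧ ∑ i, (a i + b i) = n ∧
      ∃ f : A ≃+ ∀ i, ZMod (q ^ (a i + b i)), f c = fun i => (q : ZMod (q ^ (a i + b i))) ^ b i := by
  classical
  obtain ⟨l, hl, hsum, ⟨φ⟩⟩ := exists_antitone_addEquiv_pi_zmod hq hA
  let P (s : ℕ) : Prop := ∃ b : Fin n → ℕ, ∑ i, b i = s ∧ (∀ i, b i ≤ l i) ∧
    ∃ f : A ≃+ ∀ i, ZMod (q ^ l i), f c = fun i => (q : ZMod (q ^ l i)) ^ b i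
  have hP : ∃ s, P s := by
    choose b hb u hu using fun i => exists_eq_unit_mul_pow hq (l i) (φ c i)
    exact ⟨_, b, rfl, hb,
      φ.trans (AddEquiv.piCongrRight fun i => (AddAut.mulLeft (u i)).toAdd), funext hu⟩
  obtain ⟨b, hbs, hbl, f, hf⟩ := Nat.find_spec hP
  have hchain (i j : Fin n) (hij : b i < b j) : l i - b i ≤ l j - b j := by
    by_contra! hji
    obtain ⟨g, hg⟩ := exists_addEquiv_pow_pred (q := q) hbl hij hji
    refine Nat.find_min hP (m := ∑ k, Function.update b j (b j - 1) k) ?_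
      ⟨_, rfl, fun k => ?_, f.trans g, by rw [AddEquiv.trans_apply, hf, hg]⟩
    · rw [← hbs]
      refine Finset.sum_lt_sum (fun k _ => ?_) ⟨j, Finset.mem_univ j, ?_⟩
      · by_cases hk : k = j
        · subst hk; simp
        · simp [hk]
      · simp only [Function.update_self]; omega
    · by_cases hk : k = j
      · subst hk; have := hbl k; simp only [Function.update_self]; omega
      · simpa [hk] using hbl k
  have hab (i : Fin n) : (l i - b i) + b i = l i := Nat.sub_add_cancel (hbl i)
  obtain ⟨a, ha⟩ : ∃ a : Fin n → ℕ, ∀ i, l i = a i + b i := ⟨fun i => l i - b i, fun i => (hab i).symm⟩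
  obtain rfl : l = fun i => a i + b i := funext ha
  simp only [Nat.add_sub_cancel] at hchain
  refine ⟨a, b, fun i j hij => ?_, fun i j hij => ?_, hsum, f, hf⟩
  all_goals
    have h1 := hl hij
    have h2 := hchain i j
    have h3 := hchain j i
    simp only at h1
    omega

theorem antitone_eq_of_sum_min_eq {n : ℕ} {l m : Fin n → ℕ} (hl : Antitone l) (hm : Antitone m)
    (h : ∀ k, ∑ i, min k (l i) = ∑ i, min k (m i)) : l = m := by
  have key (l : Fin n → ℕ) (k : ℕ) :
      ∑ i, min (k + 1) (l i) = ∑ i, min k (l i) + (Finset.univ.filter (k < l ·)).card := by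
    rw [Finset.card_filter, ← Finset.sum_add_distrib]
    exact Finset.sum_congr rfl fun i _ => by split_ifs <;> omega
  have hcard (k : ℕ) :
      (Finset.univ.filter (k < l ·)).card = (Finset.univ.filter (k < m ·)).card := by
    have := h k
    have := h (k + 1)
    rw [key, key] at this
    omega
  have main {l m : Fin n → ℕ} (hl : Antitone l) (hm : Antitone m) (hcard : ∀ k,
      (Finset.univ.filter (k < l ·)).card = (Finset.univ.filter (k < m ·)).card) (i : Fin n) :
      l i ≤ m i := by
    by_contra! hi
    have h1 : Finset.Iic i ⊆ Finset.univ.filter (m i < l ·) := fun j hj => by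
      have := hl (Finset.mem_Iic.1 hj)
      simp
      omega
    have h2 : Finset.univ.filter (m i < m ·) ⊆ Finset.Iio i := fun j hj => by
      rw [Finset.mem_Iio]
      by_contra! hj'
      have := hm hj'
      simp at hj
      omega
    have h3 := Finset.card_le_card h1
    have h4 := Finset.card_le_card h2
    rw [hcard, Fin.card_Iic] at h3
    rw [Fin.card_Iio] at h4
    omega
  exact funext fun i => le_antisymm (main hl hm hcard i) (main hm hl (fun k => (hcard k).symm) i)

theorem card_nsmul_ker_pi_zmod_pow {ι : Type*} [Fintype ι] {q : ℕ} (hq : 0 < q) (l : ι → ℕ) (k : ℕ) :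
    Nat.card {x : ∀ i, ZMod (q ^ l i) // q ^ k • x = 0} = q ^ ∑ i, min k (l i) := by
  have (i : ι) : NeZero (q ^ l i) := ⟨(pow_pos hq _).ne'⟩
  have e : {x : ∀ i, ZMod (q ^ l i) // q ^ k • x = 0} ≃
      ∀ i, {y : ZMod (q ^ l i) // q ^ k • y = 0} :=
    (Equiv.subtypeEquivRight fun x => funext_iff).trans
      (Equiv.subtypePiEquivPi (p := fun i (y : ZMod (q ^ l i)) => q ^ k • y = 0))
  rw [Nat.card_congr e, Nat.card_pi, ← Finset.prod_pow_eq_pow_sum]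
  refine Finset.prod_congr rfl fun i _ => ?_
  have := IsAddCyclic.card_nsmulAddMonoidHom_ker (ZMod (q ^ l i)) (q ^ k)
  rw [Nat.card_zmod, Nat.gcd_comm] at this
  refine this.trans ?_
  rcases le_total k (l i) with h | h
  · rw [min_eq_left h, Nat.gcd_eq_left (pow_dvd_pow q h)]
  · rw [min_eq_right h, Nat.gcd_eq_right (pow_dvd_pow q h)]

theorem eq_of_addEquiv_pi_zmod_pow {q : ℕ} (hq : q.Prime) {n : ℕ} {l m : Fin n → ℕ}
    (hl : Antitone l) (hm : Antitone m)
    (f : (∀ i, ZMod (q ^ l i)) ≃+ ∀ i, ZMod (q ^ m i)) : l = m := by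
  refine antitone_eq_of_sum_min_eq hl hm fun k => Nat.pow_right_injective hq.two_le ?_
  simp only [← card_nsmul_ker_pi_zmod_pow hq.pos]
  refine Nat.card_congr (f.toEquiv.subtypeEquiv fun x => ?_)
  change _ ↔ q ^ k • f x = 0
  rw [← map_nsmul, EmbeddingLike.map_eq_zero_iff]

theorem exists_pow_mul_eq_pow_iff {q : ℕ} (hq : q.Prime) {l j k : ℕ} :
    (∃ x : ZMod (q ^ l), q ^ j * x = (q : ZMod (q ^ l)) ^ k) ↔ l ≤ k ∨ j ≤ k := by
  have : NeZero (q ^ l) := ⟨(pow_pos hq.pos _).ne'⟩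
  constructor
  · rintro ⟨x, hx⟩
    by_contra! h
    have h1 : ((q ^ j * x.val : ℕ) : ZMod (q ^ l)) = (q ^ k : ℕ) := by simpa using hx
    rw [ZMod.natCast_eq_natCast_iff] at h1
    have h2 : q ^ (k + 1) ∣ q ^ k :=
      ((h1.of_dvd (pow_dvd_pow q h.1)).dvd_iff dvd_rfl).1
        ((pow_dvd_pow q h.2).mul_right _)
    have := (Nat.pow_dvd_pow_iff_le_right hq.one_lt).1 h2
    omega
  · rintro (h | h)
    · refine ⟨0, ?_⟩
      rw [mul_zero, pow_eq_zero_of_le h]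
      rw [← Nat.cast_pow, ZMod.natCast_self]
    · exact ⟨q ^ (k - j), by rw [← pow_add, Nat.add_sub_cancel' h]⟩

theorem exists_nsmul_eq_nsmul_iff {ι : Type*} {q : ℕ} (hq : q.Prime) (a b : ι → ℕ) (j k : ℕ) :
    (∃ x : ∀ i, ZMod (q ^ (a i + b i)),
        q ^ j • x = q ^ k • fun i => (q : ZMod (q ^ (a i + b i))) ^ b i) ↔
      ∀ i, a i ≤ k ∨ j ≤ k + b i := by
  have h (i : ι) := exists_pow_mul_eq_pow_iff hq (l := a i + b i) (j := j) (k := k + b i)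
  simp only [add_le_add_iff_right] at h
  simp only [← h, Classical.skolem, funext_iff]
  refine exists_congr fun x => forall_congr' fun i => ?_
  rw [Pi.smul_apply, Pi.smul_apply, nsmul_eq_mul, nsmul_eq_mul, Nat.cast_pow, Nat.cast_pow,
    ← pow_add (q : ZMod (q ^ (a i + b i)))]

theorem eq_of_addEquiv_apply_eq {q : ℕ} (hq : q.Prime) {n : ℕ} {a b a' b' : Fin n → ℕ}
    (ha : Antitone a) (hb : Antitone b) (ha' : Antitone a') (hb' : Antitone b')
    (f : (∀ i, ZMod (q ^ (a i + b i))) ≃+ ∀ i, ZMod (q ^ (a' i + b' i)))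
    (hf : f (fun i => (q : ZMod (q ^ (a i + b i))) ^ b i) =
      fun i => (q : ZMod (q ^ (a' i + b' i))) ^ b' i) : a = a' ∧ b = b' := by
  have hsum (i : Fin n) : a i + b i = a' i + b' i :=
    congrFun (eq_of_addEquiv_pi_zmod_pow hq (ha.add hb) (ha'.add hb') f) i
  have hdiv (j k : ℕ) : (∀ i, a i ≤ k ∨ j ≤ k + b i) ↔ ∀ i, a' i ≤ k ∨ j ≤ k + b' i := by
    rw [← exists_nsmul_eq_nsmul_iff hq, ← exists_nsmul_eq_nsmul_iff hq, ← f.surjective.exists.symm]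
    simp only [← hf, ← map_nsmul, f.injective.eq_iff]
  have haa (i : Fin n) : a i = a' i := by
    have h1 := (hdiv (a i + b i) (a i)).1 (fun s => ?_) i
    · have h2 := (hdiv (a' i + b' i) (a' i)).2 (fun s => ?_) i
      · have := hsum i
        omega
      · rcases le_total i s with h | h
        · exact .inl (ha' h)
        · exact .inr (Nat.add_le_add_left (hb' h) _)
    · rcases le_total i s with h | h
      · exact .inl (ha h)
      · exact .inr (Nat.add_le_add_left (hb h) _)
  exact ⟨funext haa, funext fun i => by have := hsum i; have := haa i; omega⟩

theorem card_antitone_sum_eq {m n : ℕ} (hmn : m ≤ n) :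
    Nat.card {f : Fin n → ℕ // Antitone f ∧ ∑ i, f i = m} = Fintype.card (Nat.Partition m) := by
  rw [← Nat.card_eq_fintype_card]
  refine Nat.card_congr (Equiv.ofBijective
    (fun f => Nat.Partition.ofSums m (Finset.univ.val.map f.1) f.2.2) ⟨?_, ?_⟩)
  · rintro ⟨f, hf, hfm⟩ ⟨g, hg, hgm⟩ h
    have h1 : (Finset.univ.val.map f).filter (· ≠ 0) = (Finset.univ.val.map g).filter (· ≠ 0) :=
      congrArg Nat.Partition.parts h
    have hms : Finset.univ.val.map f = Finset.univ.val.map g := by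
      rw [← Multiset.filter_add_not (· ≠ 0) (Finset.univ.val.map f),
        ← Multiset.filter_add_not (· ≠ 0) (Finset.univ.val.map g), h1]
      congr 1
      have h2 := congrArg Multiset.card (Multiset.filter_add_not (· ≠ 0) (Finset.univ.val.map f))
      have h3 := congrArg Multiset.card (Multiset.filter_add_not (· ≠ 0) (Finset.univ.val.map g))
      rw [Multiset.card_add, Multiset.card_map] at h2 h3
      simp only [not_not, Multiset.filter_eq'] at h2 h3 ⊢
      rw [Multiset.card_replicate] at h2 h3
      rw [h1] at h2
      congr 1
      omega
    have hperm : (List.ofFn f).Perm (List.ofFn g) := by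
      simpa [Fin.univ_val_map] using hms
    exact Subtype.ext (List.ofFn_injective
      (hperm.eq_of_sortedGE hf.sortedGE_ofFn hg.sortedGE_ofFn))
  · intro p
    have hcard : p.parts.card ≤ n := by
      refine le_trans ?_ hmn
      calc p.parts.card = p.parts.card • 1 := by simp
        _ ≤ p.parts.sum := Multiset.card_nsmul_le_sum fun x hx => p.parts_pos hx
        _ = m := p.parts_sum
    let s := p.parts + Multiset.replicate (n - p.parts.card) 0
    have hlen : (s.sort (· ≥ ·)).length = n := by
      simp [s, hcard]
    obtain ⟨f, hf⟩ : ∃ f : Fin n → ℕ, List.ofFn f = s.sort (· ≥ ·) :=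
      ⟨fun i => (s.sort (· ≥ ·)).get (i.cast hlen.symm), by
        apply List.ext_get <;> simp [hlen]⟩
    have hs : Finset.univ.val.map f = s := by
      rw [Fin.univ_val_map, hf, Multiset.sort_eq]
    have hsum : ∑ i, f i = m := by
      change (Finset.univ.val.map f).sum = m
      simp [hs, s, p.parts_sum]
    refine ⟨⟨f, List.sortedGE_ofFn_iff.1 ?_, hsum⟩, ?_⟩
    · rw [hf]
      exact (s.pairwise_sort (· ≥ ·)).sortedGE
    · apply Nat.Partition.ext
      change (Finset.univ.val.map f).filter (· ≠ 0) = p.parts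
      rw [hs, Multiset.filter_add, Multiset.filter_eq_self.2 fun x hx => (p.parts_pos hx).ne',
        Multiset.filter_eq_nil.2 fun x hx => by simp [Multiset.eq_of_mem_replicate hx], add_zero]

theorem card_antitone_pairs (n : ℕ) :
    Nat.card {f : (Fin n → ℕ) × (Fin n → ℕ) //
        Antitone f.1 ∧ Antitone f.2 ∧ ∑ i, (f.1 i + f.2 i) = n} =
      ∑ m ∈ Finset.range (n + 1),
        Fintype.card (Nat.Partition m) * Fintype.card (Nat.Partition (n - m)) := by
  let T (m : Fin (n + 1)) := {f : Fin n → ℕ // Antitone f ∧ ∑ i, f i = m} ×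
    {f : Fin n → ℕ // Antitone f ∧ ∑ i, f i = n - m}
  have hT (m : Fin (n + 1)) : Nat.card (T m) =
      Fintype.card (Nat.Partition m) * Fintype.card (Nat.Partition (n - m)) := by
    rw [Nat.card_prod, card_antitone_sum_eq (by omega), card_antitone_sum_eq (by omega)]
  have hpos (m : ℕ) : 0 < Fintype.card (Nat.Partition m) := Fintype.card_pos
  have (m : Fin (n + 1)) : Finite (T m) :=
    Nat.finite_of_card_ne_zero (hT m ▸ (Nat.mul_pos (hpos _) (hpos _)).ne')
  rw [Finset.sum_range, ← Finset.sum_congr rfl fun m _ => hT m, ← Nat.card_sigma]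
  exact Nat.card_congr
    { toFun := fun f => ⟨⟨∑ i, f.1.1 i, by
          have := f.2.2.2; rw [Finset.sum_add_distrib] at this; omega⟩,
        ⟨f.1.1, f.2.1, rfl⟩, ⟨f.1.2, f.2.2.1, by
          have := f.2.2.2; rw [Finset.sum_add_distrib] at this; simp only; omega⟩⟩
      invFun := fun x => ⟨(x.2.1.1, x.2.2.1), x.2.1.2.1, x.2.2.2.1, by
        rw [Finset.sum_add_distrib, x.2.1.2.2, x.2.2.2.2]; omega⟩
      left_inv := fun f => rfl
      right_inv := by
        rintro ⟨⟨m, hm⟩, ⟨f, hf, hfm⟩, ⟨g, hg, hgm⟩⟩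
        simp only at hfm
        subst hfm
        rfl }

theorem PtdAbGroup.iso_equivalence : Equivalence PtdAbGroup.Iso where
  refl P := ⟨AddEquiv.refl _, rfl⟩
  symm := fun ⟨f, hf⟩ => ⟨f.symm, by rw [← hf, AddEquiv.symm_apply_apply]⟩
  trans := fun ⟨f, hf⟩ ⟨g, hg⟩ => ⟨f.trans g, by rw [AddEquiv.trans_apply, hf, hg]⟩

/-- The standard pointed group `∏ i, ℤ / q ^ (a i + b i)` with distinguished element
`(q ^ b i)ᵢ`. -/
def PtdAbGroup.standard (q : ℕ) {n : ℕ} (a b : Fin n → ℕ) : PtdAbGroup where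
  carrier := ∀ i, ZMod (q ^ (a i + b i))
  pt := fun i => (q : ZMod (q ^ (a i + b i))) ^ b i

/-- The number of isomorphism classes of pointed abelian groups of order `q ^ n`
is `∑_{0 ≤ m ≤ n} p(m) p(n - m)`, independently of the prime `q`. -/
theorem card_ptdAbGroup_classes_eq_sum_partitions (q : ℕ) (hq : q.Prime) (n : ℕ) :
    Nat.card (Quot (fun P Q : {P : PtdAbGroup // Nat.card P.carrier = q ^ n} =>
        PtdAbGroup.Iso P.1 Q.1)) =
      ∑ m ∈ Finset.range (n + 1),
        Fintype.card (Nat.Partition m) * Fintype.card (Nat.Partition (n - m)) := by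
  rw [← card_antitone_pairs]
  symm
  refine Nat.card_congr (Equiv.ofBijective
    (fun f => Quot.mk _ ⟨PtdAbGroup.standard q f.1.1 f.1.2,
      (card_pi_zmod_pow q _).trans (by rw [f.2.2.2])⟩) ⟨?_, ?_⟩)
  · rintro ⟨⟨a, b⟩, ha, hb, _⟩ ⟨⟨a', b'⟩, ha', hb', _⟩ h
    obtain ⟨f, hf⟩ := ((PtdAbGroup.iso_equivalence.comap Subtype.val).eqvGen_iff).1
      (Quot.eqvGen_exact h)
    obtain ⟨rfl, rfl⟩ := eq_of_addEquiv_apply_eq hq ha hb ha' hb' f hf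
    rfl
  · rintro ⟨⟨P, hP⟩⟩
    obtain ⟨a, b, ha, hb, hab, f, hf⟩ := exists_antitone_addEquiv_apply_eq_pow hq hP P.pt
    exact ⟨⟨(a, b), ha, hb, hab⟩, Quot.sound (PtdAbGroup.iso_equivalence.symm ⟨f, hf⟩)⟩
end

section
/- For every natural number n, the partition number p(n) equals the sum over all pairs (k,l) with 0 ≤ k ≤ l ≤ n of |A(k,l)|·|B(k,n-l)|, where A(k,l) = {(x_1,…,x_k) ∈ ℤ^k : 1 ≤ x_1 < ⋯ < x_k, x_1 + ⋯ + x_k = l} and B(k,l) = {(x_1,…,x_k) ∈ ℤ^k : 0 ≤ x_1 < ⋯ < x_k, x_1 + ⋯ + x_k = l}. -/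
/-- `A(k,l)`: strictly increasing `k`-tuples of positive integers summing to `l`. -/
def setA (k : ℕ) (l : ℤ) : Set (Fin k → ℤ) :=
  {x | StrictMono x ∧ (∀ i, 1 ≤ x i) ∧ ∑ i, x i = l}

/-- `B(k,l)`: strictly increasing `k`-tuples of nonnegative integers summing to `l`. -/
def setB (k : ℕ) (l : ℤ) : Set (Fin k → ℤ) :=
  {x | StrictMono x ∧ (∀ i, 0 ≤ x i) ∧ ∑ i, x i = l}

namespace YoungDiagram

/-- The number of cells on the main diagonal of a Young diagram. -/
def diagLen (μ : YoungDiagram) : ℕ :=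
  {c ∈ μ.cells | c.1 = c.2}.card

/-- The number of cells of a Young diagram lying on or to the right of the main diagonal. -/
def upperCard (μ : YoungDiagram) : ℕ :=
  {c ∈ μ.cells | c.1 ≤ c.2}.card

/-- The number of cells of a Young diagram lying strictly below the main diagonal. -/
def lowerCard (μ : YoungDiagram) : ℕ :=
  {c ∈ μ.cells | ¬ c.1 ≤ c.2}.card

theorem upperCard_add_lowerCard (μ : YoungDiagram) : μ.upperCard + μ.lowerCard = μ.card :=
  Finset.card_filter_add_card_filter_not _

theorem diagLen_eq_of_forall {μ : YoungDiagram} {k : ℕ} (h : ∀ i, (i, i) ∈ μ ↔ i < k) :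
    μ.diagLen = k := by
  have : {c ∈ μ.cells | c.1 = c.2} = (Finset.range k).image fun i => (i, i) := by
    ext ⟨i, j⟩
    simp only [Finset.mem_filter, mem_cells, Finset.mem_image, Finset.mem_range, Prod.mk.injEq]
    constructor
    · rintro ⟨hm, rfl⟩
      exact ⟨i, (h i).1 hm, rfl, rfl⟩
    · rintro ⟨a, ha, rfl, rfl⟩
      exact ⟨(h a).2 ha, rfl⟩
  rw [diagLen, this, Finset.card_image_of_injective _ fun a b hab => (Prod.mk.inj hab).1,
    Finset.card_range]

theorem mem_diag_iff (μ : YoungDiagram) (i : ℕ) : (i, i) ∈ μ ↔ i < μ.diagLen := by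
  have hex : ∃ i, (i, i) ∉ μ := by
    obtain ⟨j, hj⟩ := μ.exists_notMem_row 0
    exact ⟨j, fun h => hj (μ.up_left_mem (Nat.zero_le _) le_rfl h)⟩
  have key : ∀ i, (i, i) ∈ μ ↔ i < Nat.find hex := fun i => by
    rw [Nat.lt_find_iff]
    push Not
    exact ⟨fun h m hm => μ.up_left_mem hm hm h, fun h => h i le_rfl⟩
  rw [diagLen_eq_of_forall key, key]

theorem lt_rowLen_of_lt_diagLen {μ : YoungDiagram} {i : ℕ} (h : i < μ.diagLen) :
    i < μ.rowLen i :=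
  mem_iff_lt_rowLen.1 ((μ.mem_diag_iff i).2 h)

theorem lt_colLen_of_lt_diagLen {μ : YoungDiagram} {i : ℕ} (h : i < μ.diagLen) :
    i < μ.colLen i :=
  mem_iff_lt_colLen.1 ((μ.mem_diag_iff i).2 h)

theorem upperCard_eq_sum (μ : YoungDiagram) :
    μ.upperCard = ∑ i ∈ Finset.range μ.diagLen, (μ.rowLen i - i) := by
  rw [upperCard, Finset.card_eq_sum_card_fiberwise (f := Prod.fst)
    (t := Finset.range μ.diagLen)]
  · refine Finset.sum_congr rfl fun i _ => ?_
    have : {c ∈ {c ∈ μ.cells | c.1 ≤ c.2} | c.1 = i} =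
        (Finset.Ico i (μ.rowLen i)).image (Prod.mk i) := by
      ext ⟨a, b⟩
      simp only [Finset.mem_filter, mem_cells, Finset.mem_image, Finset.mem_Ico, Prod.mk.injEq,
        mem_iff_lt_rowLen]
      constructor
      · rintro ⟨⟨h1, h2⟩, rfl⟩
        exact ⟨b, ⟨h2, h1⟩, rfl, rfl⟩
      · rintro ⟨c, ⟨h1, h2⟩, rfl, rfl⟩
        exact ⟨⟨h2, h1⟩, rfl⟩
    rw [this, Finset.card_image_of_injective _ (Prod.mk_right_injective i), Nat.card_Ico]
  · rintro ⟨a, b⟩ hc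
    simp only [Finset.coe_filter, mem_cells, Set.mem_ofPred_eq] at hc
    simpa [← mem_diag_iff] using μ.up_left_mem le_rfl hc.2 hc.1

theorem lowerCard_eq_sum (μ : YoungDiagram) :
    μ.lowerCard = ∑ j ∈ Finset.range μ.diagLen, (μ.colLen j - (j + 1)) := by
  rw [lowerCard, Finset.card_eq_sum_card_fiberwise (f := Prod.snd)
    (t := Finset.range μ.diagLen)]
  · refine Finset.sum_congr rfl fun j _ => ?_
    have : {c ∈ {c ∈ μ.cells | ¬ c.1 ≤ c.2} | c.2 = j} =
        (Finset.Ico (j + 1) (μ.colLen j)).image (fun i => (i, j)) := by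
      ext ⟨a, b⟩
      simp only [Finset.mem_filter, mem_cells, Finset.mem_image, Finset.mem_Ico, Prod.mk.injEq,
        mem_iff_lt_colLen, not_le]
      constructor
      · rintro ⟨⟨h1, h2⟩, rfl⟩
        exact ⟨a, ⟨h2, h1⟩, rfl, rfl⟩
      · rintro ⟨c, ⟨h1, h2⟩, rfl, rfl⟩
        exact ⟨⟨h2, h1⟩, rfl⟩
    rw [this, Finset.card_image_of_injective _ (Prod.mk_left_injective j), Nat.card_Ico]
  · rintro ⟨a, b⟩ hc
    simp only [Finset.coe_filter, mem_cells, Set.mem_ofPred_eq, not_le] at hc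
    simpa [← mem_diag_iff] using μ.up_left_mem hc.2.le le_rfl hc.1

theorem diagLen_le_upperCard (μ : YoungDiagram) : μ.diagLen ≤ μ.upperCard :=
  Finset.card_le_card fun _ => by
    simp only [Finset.mem_filter]
    exact fun h => ⟨h.1, h.2.le⟩

/-- The first `k` arm lengths of a Young diagram, diagonal cells included, in reverse order. -/
def arms (μ : YoungDiagram) (k : ℕ) (i : Fin k) : ℤ :=
  μ.rowLen i.rev - (i.rev : ℕ)

/-- The first `k` leg lengths of a Young diagram, diagonal cells excluded, in reverse order. -/
def legs (μ : YoungDiagram) (k : ℕ) (i : Fin k) : ℤ :=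
  μ.colLen i.rev - ((i.rev : ℕ) + 1)

theorem strictMono_arms (μ : YoungDiagram) (k : ℕ) : StrictMono (μ.arms k) := fun i j h => by
  have h' : (j.rev : ℕ) < i.rev := Fin.rev_lt_rev.2 h
  have := μ.rowLen_anti _ _ h'.le
  simp only [arms]
  lia

theorem strictMono_legs (μ : YoungDiagram) (k : ℕ) : StrictMono (μ.legs k) := fun i j h => by
  have h' : (j.rev : ℕ) < i.rev := Fin.rev_lt_rev.2 h
  have := μ.colLen_anti _ _ h'.le
  simp only [legs]
  lia

theorem one_le_arms (μ : YoungDiagram) (i : Fin μ.diagLen) : 1 ≤ μ.arms μ.diagLen i := by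
  have := lt_rowLen_of_lt_diagLen i.rev.isLt
  simp only [arms]
  lia

theorem legs_nonneg (μ : YoungDiagram) (i : Fin μ.diagLen) : 0 ≤ μ.legs μ.diagLen i := by
  have := lt_colLen_of_lt_diagLen i.rev.isLt
  simp only [legs]
  lia

theorem sum_arms (μ : YoungDiagram) : ∑ i, μ.arms μ.diagLen i = μ.upperCard := by
  rw [upperCard_eq_sum, ← Fin.sum_univ_eq_sum_range (fun i => μ.rowLen i - i), Nat.cast_sum,
    ← Equiv.sum_comp Fin.revPerm]
  refine Finset.sum_congr rfl fun i _ => ?_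
  have := lt_rowLen_of_lt_diagLen i.isLt
  simp only [arms, Fin.revPerm_apply, Fin.rev_rev]
  lia

theorem sum_legs (μ : YoungDiagram) : ∑ i, μ.legs μ.diagLen i = μ.lowerCard := by
  rw [lowerCard_eq_sum, ← Fin.sum_univ_eq_sum_range (fun i => μ.colLen i - (i + 1)),
    Nat.cast_sum, ← Equiv.sum_comp Fin.revPerm]
  refine Finset.sum_congr rfl fun i _ => ?_
  have := lt_colLen_of_lt_diagLen i.isLt
  simp only [legs, Fin.revPerm_apply, Fin.rev_rev]
  lia

/-- The cells of the Young diagram with arms `x` (diagonal included) and legs `y`, both listed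
in reverse order. -/
def frobeniusCells {k : ℕ} (x y : Fin k → ℤ) : Finset (ℕ × ℕ) :=
  (Finset.univ.biUnion fun i : Fin k =>
    (Finset.Ico (i : ℕ) (i + (x i.rev).toNat)).image (Prod.mk (i : ℕ))) ∪
  (Finset.univ.biUnion fun j : Fin k =>
    (Finset.Ico (j + 1 : ℕ) (j + 1 + (y j.rev).toNat)).image fun i => (i, (j : ℕ)))

theorem mem_frobeniusCells {k : ℕ} {x y : Fin k → ℤ} {i j : ℕ} :
    (i, j) ∈ frobeniusCells x y ↔
      (i ≤ j ∧ ∃ h : i < k, (j : ℤ) < i + x (Fin.rev ⟨i, h⟩)) ∨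
      (j < i ∧ ∃ h : j < k, (i : ℤ) < j + 1 + y (Fin.rev ⟨j, h⟩)) := by
  simp only [frobeniusCells, Finset.mem_union, Finset.mem_biUnion, Finset.mem_univ, true_and,
    Finset.mem_image, Finset.mem_Ico, Prod.mk.injEq]
  refine or_congr ⟨?_, ?_⟩ ⟨?_, ?_⟩
  · rintro ⟨a, b, h, rfl, rfl⟩
    exact ⟨h.1, a.isLt, by simp only [Fin.eta]; lia⟩
  · rintro ⟨h, hk, hx⟩
    exact ⟨⟨i, hk⟩, j, ⟨h, by simp only; lia⟩, rfl, rfl⟩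
  · rintro ⟨a, b, h, rfl, rfl⟩
    exact ⟨h.1, a.isLt, by simp only [Fin.eta]; lia⟩
  · rintro ⟨h, hk, hx⟩
    exact ⟨⟨j, hk⟩, i, ⟨h, by simp only; lia⟩, rfl, rfl⟩

theorem rev_add_le_of_strictMono {k : ℕ} {x : Fin k → ℤ} (hx : StrictMono x) {i j : ℕ} (hij : i ≤ j)
    (hj : j < k) :
    j + x (Fin.rev ⟨j, hj⟩) ≤ i + x (Fin.rev ⟨i, hij.trans_lt hj⟩) := by
  induction j, hij using Nat.le_induction with
  | base => exact le_rfl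
  | succ j hij ih =>
    have h : x (Fin.rev ⟨j + 1, hj⟩) < x (Fin.rev ⟨j, by lia⟩) :=
      hx (Fin.rev_lt_rev.2 (Fin.mk_lt_mk.2 j.lt_succ_self))
    have := ih (by lia)
    push_cast
    lia

/-- The Young diagram with arms `x` (diagonal included) and legs `y`, both listed in reverse
order. -/
def ofFrobenius {k : ℕ} (x y : Fin k → ℤ) (hx : StrictMono x) (hy : StrictMono y)
    (hx1 : ∀ i, 1 ≤ x i) (hy0 : ∀ i, 0 ≤ y i) : YoungDiagram where
  cells := frobeniusCells x y
  isLowerSet := by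
    rintro ⟨i₂, j₂⟩ ⟨i₁, j₁⟩ ⟨hi : i₁ ≤ i₂, hj : j₁ ≤ j₂⟩ hc
    rw [Finset.mem_coe, mem_frobeniusCells] at hc ⊢
    rcases hc with ⟨h, hk, hc⟩ | ⟨h, hk, hc⟩ <;> rcases le_or_gt i₁ j₁ with h₁ | h₁
    · have := rev_add_le_of_strictMono hx hi hk
      exact Or.inl ⟨h₁, by lia, by lia⟩
    · have := rev_add_le_of_strictMono hy (h₁.le.trans hi) hk
      have := hy0 (Fin.rev ⟨i₂, hk⟩)
      exact Or.inr ⟨h₁, by lia, by lia⟩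
    · have := rev_add_le_of_strictMono hx (h₁.trans hj) hk
      have := hx1 (Fin.rev ⟨j₂, hk⟩)
      exact Or.inl ⟨h₁, by lia, by lia⟩
    · have := rev_add_le_of_strictMono hy hj hk
      exact Or.inr ⟨h₁, by lia, by lia⟩

section OfFrobenius

variable {k : ℕ} {x y : Fin k → ℤ} {hx : StrictMono x} {hy : StrictMono y}
  {hx1 : ∀ i, 1 ≤ x i} {hy0 : ∀ i, 0 ≤ y i}

theorem mem_ofFrobenius {i j : ℕ} :
    (i, j) ∈ ofFrobenius x y hx hy hx1 hy0 ↔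
      (i ≤ j ∧ ∃ h : i < k, (j : ℤ) < i + x (Fin.rev ⟨i, h⟩)) ∨
      (j < i ∧ ∃ h : j < k, (i : ℤ) < j + 1 + y (Fin.rev ⟨j, h⟩)) :=
  mem_frobeniusCells

theorem diagLen_ofFrobenius : (ofFrobenius x y hx hy hx1 hy0).diagLen = k := by
  refine diagLen_eq_of_forall fun i => ?_
  rw [mem_ofFrobenius]
  constructor
  · rintro (⟨-, h, -⟩ | ⟨-, h, -⟩) <;> exact h
  · intro h
    have := hx1 (Fin.rev ⟨i, h⟩)
    exact Or.inl ⟨le_rfl, h, by lia⟩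

theorem arms_ofFrobenius : (ofFrobenius x y hx hy hx1 hy0).arms k = x := by
  funext i
  obtain ⟨i, rfl⟩ := Fin.rev_surjective i
  have h1 := hx1 i.rev
  have key : (ofFrobenius x y hx hy hx1 hy0).rowLen i = (i + x i.rev).toNat := by
    refine eq_of_forall_lt_iff fun j => ?_
    rw [← mem_iff_lt_rowLen, mem_ofFrobenius]
    have hi := i.isLt
    constructor
    · rintro (⟨h, _, h2⟩ | ⟨h, -⟩)
      · simp only [Fin.eta] at h2
        lia
      · lia
    · intro h
      rcases le_or_gt (i : ℕ) j with hij | hij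
      · exact Or.inl ⟨hij, hi, by simp only [Fin.eta]; lia⟩
      · have := rev_add_le_of_strictMono hy hij.le hi
        have := hy0 (Fin.rev ⟨i, hi⟩)
        exact Or.inr ⟨hij, by lia, by lia⟩
  rw [arms, Fin.rev_rev, key]
  lia

theorem legs_ofFrobenius : (ofFrobenius x y hx hy hx1 hy0).legs k = y := by
  funext j
  obtain ⟨j, rfl⟩ := Fin.rev_surjective j
  have h1 := hy0 j.rev
  have key : (ofFrobenius x y hx hy hx1 hy0).colLen j = (j + 1 + y j.rev).toNat := by
    refine eq_of_forall_lt_iff fun i => ?_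
    rw [← mem_iff_lt_colLen, mem_ofFrobenius]
    have hj := j.isLt
    constructor
    · rintro (⟨h, -⟩ | ⟨h, _, h2⟩)
      · lia
      · simp only [Fin.eta] at h2
        lia
    · intro h
      rcases le_or_gt i (j : ℕ) with hij | hij
      · have := rev_add_le_of_strictMono hx hij hj
        have := hx1 (Fin.rev ⟨j, hj⟩)
        exact Or.inl ⟨hij, by lia, by lia⟩
      · exact Or.inr ⟨hij, hj, by simp only [Fin.eta]; lia⟩
  rw [legs, Fin.rev_rev, key]
  lia

end OfFrobenius

theorem ofFrobenius_arms_legs (μ : YoungDiagram) :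
    ofFrobenius (μ.arms μ.diagLen) (μ.legs μ.diagLen) (μ.strictMono_arms _) (μ.strictMono_legs _)
      μ.one_le_arms μ.legs_nonneg = μ := by
  ext ⟨i, j⟩
  rw [mem_cells, mem_cells, mem_ofFrobenius]
  simp only [arms, legs, Fin.rev_rev]
  constructor
  · rintro (⟨-, -, h⟩ | ⟨-, -, h⟩)
    · exact mem_iff_lt_rowLen.2 (by lia)
    · exact mem_iff_lt_colLen.2 (by lia)
  · intro h
    rcases le_or_gt i j with hij | hij
    · have hd := (μ.mem_diag_iff i).1 (μ.up_left_mem le_rfl hij h)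
      have := mem_iff_lt_rowLen.1 h
      exact Or.inl ⟨hij, hd, by lia⟩
    · have hd := (μ.mem_diag_iff j).1 (μ.up_left_mem hij.le le_rfl h)
      have := mem_iff_lt_colLen.1 h
      exact Or.inr ⟨hij, hd, by lia⟩

/-- Frobenius coordinates: Young diagrams with given diagonal length and given number of cells
weakly above and strictly below the diagonal correspond to pairs of strictly increasing tuples. -/
def frobeniusEquiv (k l m : ℕ) :
    {μ : YoungDiagram // μ.diagLen = k ∧ μ.upperCard = l ∧ μ.lowerCard = m} ≃
      setA k l × setB k m where
  toFun μ :=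
    (⟨μ.1.arms k, μ.1.strictMono_arms k, by
        obtain ⟨μ, rfl, rfl, rfl⟩ := μ
        exact ⟨μ.one_le_arms, μ.sum_arms⟩⟩,
      ⟨μ.1.legs k, μ.1.strictMono_legs k, by
        obtain ⟨μ, rfl, rfl, rfl⟩ := μ
        exact ⟨μ.legs_nonneg, μ.sum_legs⟩⟩)
  invFun p :=
    ⟨ofFrobenius p.1.1 p.2.1 p.1.2.1 p.2.2.1 p.1.2.2.1 p.2.2.2.1, by
      obtain ⟨⟨x, hx, hx1, hxs⟩, ⟨y, hy, hy0, hys⟩⟩ := p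
      have hd := diagLen_ofFrobenius (hx := hx) (hy := hy) (hx1 := hx1) (hy0 := hy0)
      have hs := sum_arms (ofFrobenius x y hx hy hx1 hy0)
      have ht := sum_legs (ofFrobenius x y hx hy hx1 hy0)
      rw [hd, arms_ofFrobenius, hxs] at hs
      rw [hd, legs_ofFrobenius, hys] at ht
      exact ⟨hd, by exact_mod_cast hs.symm, by exact_mod_cast ht.symm⟩⟩
  left_inv := by
    rintro ⟨μ, rfl, rfl, rfl⟩
    exact Subtype.ext μ.ofFrobenius_arms_legs
  right_inv := by
    rintro ⟨⟨x, hx, hx1, hxs⟩, ⟨y, hy, hy0, hys⟩⟩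
    exact Prod.ext (Subtype.ext (arms_ofFrobenius (hx := hx) (hy := hy) (hx1 := hx1) (hy0 := hy0)))
      (Subtype.ext (legs_ofFrobenius (hx := hx) (hy := hy) (hx1 := hx1) (hy0 := hy0)))

theorem sum_rowLens (μ : YoungDiagram) : μ.rowLens.sum = μ.card := by
  rw [YoungDiagram.card, Finset.card_eq_sum_card_fiberwise (f := Prod.fst)
    (t := Finset.range (μ.colLen 0))]
  · exact Finset.sum_congr (s₁ := Finset.range (μ.colLen 0)) rfl fun i _ => μ.rowLen_eq_card
  · rintro ⟨a, b⟩ hc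
    simpa [← mem_iff_lt_colLen] using μ.up_left_mem le_rfl (Nat.zero_le b) hc

/-- Young diagrams with `n` cells correspond to partitions of `n`. -/
def equivPartition (n : ℕ) : {μ : YoungDiagram // μ.card = n} ≃ Nat.Partition n where
  toFun μ := ⟨μ.1.rowLens, fun h => μ.1.pos_of_mem_rowLens _ h, by
    rw [Multiset.sum_coe, sum_rowLens, μ.2]⟩
  invFun p :=
    ⟨equivListRowLens.symm ⟨p.parts.sort (· ≥ ·), (Multiset.pairwise_sort _ _).sortedGE,
      fun _ h => p.parts_pos ((Multiset.mem_sort _).1 h)⟩, by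
      rw [← sum_rowLens, ← equivListRowLens_apply_coe, Equiv.apply_symm_apply,
        ← Multiset.sum_coe, Multiset.sort_eq, p.parts_sum]⟩
  left_inv μ := by
    apply Subtype.ext
    rw [Equiv.symm_apply_eq]
    apply Subtype.ext
    simp only [equivListRowLens_apply_coe]
    refine List.Perm.eq_of_pairwise' (Multiset.pairwise_sort _ _) μ.1.rowLens_sorted.pairwise ?_
    rw [← Multiset.coe_eq_coe, Multiset.sort_eq]
  right_inv p := by
    apply Nat.Partition.ext
    simp only [← equivListRowLens_apply_coe, Equiv.apply_symm_apply, Multiset.sort_eq]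

theorem finite_setOf_card_eq (n : ℕ) : {μ : YoungDiagram | μ.card = n}.Finite :=
  Set.finite_coe_iff.1 (Finite.of_equiv _ (equivPartition n).symm)

end YoungDiagram

theorem partition_eq_sum_card_A_mul_card_B (n : ℕ) :
    Fintype.card (Nat.Partition n) =
      ∑ l ∈ Finset.range (n + 1), ∑ k ∈ Finset.range (l + 1),
        Nat.card (setA k l) * Nat.card (setB k ((n : ℤ) - l)) := by
  have hT : Fintype.card (Nat.Partition n) = (YoungDiagram.finite_setOf_card_eq n).toFinset.card := by
    rw [← Nat.card_eq_fintype_card, ← Nat.card_congr (YoungDiagram.equivPartition n),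
      ← Nat.card_eq_card_finite_toFinset]
    rfl
  rw [hT, Finset.card_eq_sum_card_fiberwise (f := YoungDiagram.upperCard) (t := Finset.range (n + 1))]
  · refine Finset.sum_congr rfl fun l hl => ?_
    rw [Finset.card_eq_sum_card_fiberwise (f := YoungDiagram.diagLen) (t := Finset.range (l + 1))]
    · refine Finset.sum_congr rfl fun k _ => ?_
      rw [← Nat.cast_sub (Finset.mem_range_succ_iff.1 hl), ← Nat.card_prod,
        ← Nat.card_congr (YoungDiagram.frobeniusEquiv k l (n - l)), ← Nat.card_eq_finsetCard]
      refine Nat.card_congr (Equiv.subtypeEquivRight fun μ => ?_)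
      have := μ.upperCard_add_lowerCard
      have := Finset.mem_range_succ_iff.1 hl
      simp only [Finset.mem_filter, Set.Finite.mem_toFinset, Set.mem_ofPred_eq]
      lia
    · intro μ hμ
      simp only [Finset.coe_filter, Set.mem_ofPred_eq] at hμ
      simpa [← hμ.2, Nat.lt_succ_iff] using μ.diagLen_le_upperCard
  · intro μ hμ
    have := μ.upperCard_add_lowerCard
    simp only [Set.Finite.coe_toFinset, Set.mem_ofPred_eq] at hμ
    simp only [Finset.coe_range, Set.mem_Iio]
    lia
end

section
/- For every natural number n, the partition number p(n) equals the sum over all pairs (k,l) with 0 ≤ k ≤ l ≤ n of |B(k,l-k)|·|B(k,n-l)|, where B(k,l) = {(x_1,…,x_k) ∈ ℤ^k : 0 ≤ x_1 < ⋯ < x_k, x_1 + ⋯ + x_k = l}. -/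
open Finset

/-- The finite sets of natural numbers with `k` elements and sum `l`. -/
def finsetsCardSum (k l : ℕ) : Finset (Finset ℕ) :=
  {A ∈ (range (l + 1)).powerset | A.card = k ∧ ∑ x ∈ A, x = l}

theorem mem_finsetsCardSum {k l : ℕ} {A : Finset ℕ} :
    A ∈ finsetsCardSum k l ↔ A.card = k ∧ ∑ x ∈ A, x = l := by
  simp only [finsetsCardSum, mem_filter, mem_powerset, and_iff_right_iff_imp]
  rintro ⟨-, rfl⟩ x hx
  exact mem_range.2 (Nat.lt_succ_of_le (single_le_sum (f := fun x => x) (by simp) hx))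

theorem sum_orderEmbOfFin {k : ℕ} (A : Finset ℕ) (h : A.card = k) :
    ∑ i, A.orderEmbOfFin h i = ∑ x ∈ A, x := by
  have := congrArg (fun S : Finset ℕ => ∑ x ∈ S, x) (A.map_orderEmbOfFin_univ h)
  simp only [sum_map] at this
  exact this

theorem card_setB_eq_card_finsetsCardSum (k l : ℕ) :
    Nat.card (setB k l) = (finsetsCardSum k l).card := by
  rw [← Nat.card_eq_finsetCard]
  symm
  refine Nat.card_eq_of_bijective
    (fun A : finsetsCardSum k l =>
      (⟨fun i => (A.1.orderEmbOfFin (mem_finsetsCardSum.1 A.2).1 i : ℤ), ?_, fun i => by simp,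
        ?_⟩ : setB k l)) ⟨?_, ?_⟩
  · exact Nat.strictMono_cast.comp (OrderEmbedding.strictMono _)
  · rw [← Nat.cast_sum, sum_orderEmbOfFin, (mem_finsetsCardSum.1 A.2).2]
  · rintro ⟨A, hA⟩ ⟨B, hB⟩ h
    have h' := congrArg Subtype.val h
    simp only [funext_iff, Nat.cast_inj] at h'
    apply Subtype.ext
    change A = B
    rw [← A.image_orderEmbOfFin_univ (mem_finsetsCardSum.1 hA).1,
      ← B.image_orderEmbOfFin_univ (mem_finsetsCardSum.1 hB).1]
    exact image_congr fun i _ => h' i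
  · rintro ⟨x, hx, hx0, hsum⟩
    lift x to Fin k → ℕ using hx0
    beta_reduce at hsum
    have hmono : StrictMono x := fun i j hij => Nat.cast_lt.1 (hx hij)
    have hcard : (univ.image x).card = k := by simp [card_image_of_injective _ hmono.injective]
    have hmem : univ.image x ∈ finsetsCardSum k l := mem_finsetsCardSum.2 ⟨hcard, by
      rw [sum_image hmono.injective.injOn]; exact_mod_cast hsum⟩
    refine ⟨⟨_, hmem⟩, Subtype.ext ?_⟩
    have := orderEmbOfFin_unique hcard (f := x) (by simp) hmono
    funext i
    exact congrArg Nat.cast (congrFun this i).symm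

theorem add_sub_le_of_strictMono {n : ℕ} {x : Fin n → ℕ} (hx : StrictMono x) {i j : Fin n}
    (hij : i ≤ j) : x i + (j - i : ℕ) ≤ x j := by
  obtain ⟨j, hj⟩ := j
  induction j with
  | zero =>
    have : i = ⟨0, hj⟩ := le_antisymm hij (Fin.mk_le_of_le_val (Nat.zero_le _))
    simp [this]
  | succ j ih =>
    rcases hij.eq_or_lt with rfl | hlt
    · simp
    · have hlt' : i.val < j + 1 := hlt
      have h1 := ih (by omega) (show i.val ≤ j by omega)
      have h2 : x ⟨j, by omega⟩ < x ⟨j + 1, hj⟩ := hx (by simp)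
      simp only at h1 ⊢
      omega

theorem card_partition_eq_card_finsetsCardSum (n : ℕ) :
    Fintype.card (Nat.Partition n) = (finsetsCardSum n (n + ∑ i ∈ range n, i)).card := by
  have hval {A : Finset ℕ} (h : A.card = n) (i : Fin n) : i.val ≤ A.orderEmbOfFin h i := by
    have : NeZero n := ⟨fun h0 => by subst h0; exact i.elim0⟩
    have := add_sub_le_of_strictMono (A.orderEmbOfFin h).strictMono (Fin.zero_le i)
    simp only [Fin.val_zero] at this
    omega
  have hgap (A : Finset ℕ) (h : A.card = n) :
      Monotone fun i : Fin n => A.orderEmbOfFin h i - i := fun i j hij => by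
    have := add_sub_le_of_strictMono (A.orderEmbOfFin h).strictMono hij
    have := hval h i
    have : i.val ≤ j.val := hij
    change A.orderEmbOfFin h i - i ≤ A.orderEmbOfFin h j - j
    omega
  have hsum (A : Finset ℕ) (hA : A ∈ finsetsCardSum n (n + ∑ i ∈ range n, i)) :
      (univ.val.map fun i : Fin n =>
        A.orderEmbOfFin (mem_finsetsCardSum.1 hA).1 i - i).sum = n := by
    obtain ⟨h, hs⟩ := mem_finsetsCardSum.1 hA
    change ∑ i : Fin n, (A.orderEmbOfFin h i - i) = n
    have : ∑ i : Fin n, (A.orderEmbOfFin h i - i + i) = n + ∑ i ∈ range n, i := by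
      rw [← hs, ← sum_orderEmbOfFin A h]
      exact sum_congr rfl fun i _ => Nat.sub_add_cancel (hval h i)
    rw [sum_add_distrib, Fin.sum_univ_eq_sum_range (fun i => i)] at this
    omega
  rw [← card_univ]
  symm
  refine card_bij (fun A hA => Nat.Partition.ofSums n _ (hsum A hA)) (by simp) ?_ ?_
  · intro A hA B hB h
    obtain ⟨hAc, -⟩ := mem_finsetsCardSum.1 hA
    obtain ⟨hBc, -⟩ := mem_finsetsCardSum.1 hB
    have hparts := congrArg Nat.Partition.parts h
    simp only [Nat.Partition.ofSums] at hparts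
    have hmul : (univ.val.map fun i : Fin n => A.orderEmbOfFin hAc i - i) =
        univ.val.map fun i : Fin n => B.orderEmbOfFin hBc i - i := by
      have key {s : Multiset ℕ} (hs : s.card = n) :
          s = s.filter (· ≠ 0) + Multiset.replicate (n - (s.filter (· ≠ 0)).card) 0 := by
        have h1 := Multiset.filter_add_not (· ≠ 0) s
        have h2 : s.filter (fun a => ¬ a ≠ 0) =
            Multiset.replicate (n - (s.filter (· ≠ 0)).card) 0 := by
          rw [Multiset.eq_replicate]
          refine ⟨?_, by simp⟩
          rw [← hs]; nth_rw 2 [← h1]; simp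
        rw [← h2, h1]
      rw [key (s := univ.val.map fun i : Fin n => A.orderEmbOfFin hAc i - i) (by simp), hparts,
        ← key (by simp)]
    have hlist : List.ofFn (fun i : Fin n => A.orderEmbOfFin hAc i - i) =
        List.ofFn (fun i : Fin n => B.orderEmbOfFin hBc i - i) := by
      refine List.Perm.eq_of_sortedLE (List.sortedLE_ofFn_iff.2 (hgap A hAc))
        (List.sortedLE_ofFn_iff.2 (hgap B hBc)) (Multiset.coe_eq_coe.1 ?_)
      simpa [Fin.univ_val_map] using hmul
    rw [← A.image_orderEmbOfFin_univ hAc, ← B.image_orderEmbOfFin_univ hBc]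
    refine image_congr fun i _ => ?_
    have h1 := congrFun (List.ofFn_injective hlist) i
    have h2 := hval hAc i
    have h3 := hval hBc i
    omega
  · intro p _
    have hpc : p.parts.card ≤ n := by
      conv_rhs => rw [← p.parts_sum]
      simpa using Multiset.card_nsmul_le_sum (s := p.parts) (a := 1) fun _ hi => p.parts_pos hi
    set s := p.parts + Multiset.replicate (n - p.parts.card) 0 with hs
    obtain ⟨y, hy, hys⟩ : ∃ y : Fin n → ℕ, Monotone y ∧ univ.val.map y = s := by
      have hlen : s.sort.length = n := by rw [Multiset.length_sort, hs]; simp [hpc]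
      refine ⟨fun i => s.sort.get (i.cast hlen.symm), ?_, ?_⟩
      · exact fun i j hij => (Multiset.pairwise_sort s (· ≤ ·)).sortedLE.monotone_get hij
      · rw [Fin.univ_val_map]
        conv_rhs => rw [← Multiset.sort_eq s (· ≤ ·)]
        congr 1
        apply List.ext_get
        · simp [hlen]
        · simp
    set x : Fin n → ℕ := fun i => y i + i with hxdef
    have hx : StrictMono x := fun i j hij =>
      add_lt_add_of_le_of_lt (hy hij.le) hij
    have hcard : (univ.image x).card = n := by simp [card_image_of_injective _ hx.injective]
    have hysum : ∑ i, y i = n := by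
      change (univ.val.map y).sum = n
      rw [hys, hs]; simp [p.parts_sum]
    have hmem : univ.image x ∈ finsetsCardSum n (n + ∑ i ∈ range n, i) :=
      mem_finsetsCardSum.2 ⟨hcard, by
        rw [sum_image hx.injective.injOn, hxdef, sum_add_distrib, hysum,
          Fin.sum_univ_eq_sum_range (fun i => i)]⟩
    refine ⟨_, hmem, ?_⟩
    have hfun := orderEmbOfFin_unique hcard (f := x) (by simp) hx
    have hdiff : (fun i : Fin n => (univ.image x).orderEmbOfFin hcard i - i) = y := by
      rw [← hfun]; funext i; simp [hxdef]
    ext1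
    simp only [Nat.Partition.ofSums, hdiff, hys, hs, Multiset.filter_add]
    rw [Multiset.filter_eq_self.2 fun a ha => (p.parts_pos ha).ne',
      Multiset.filter_eq_nil.2 fun a ha => by simp [Multiset.eq_of_mem_replicate ha], add_zero]

/-- The elements of `S` that are at least `n`, shifted down by `n`. -/
def particles (n : ℕ) (S : Finset ℕ) : Finset ℕ := {x ∈ S | n ≤ x}.image (· - n)

/-- The elements of `range n` missing from `S`, reflected. -/
def holes (n : ℕ) (S : Finset ℕ) : Finset ℕ := (range n \ S).image (n - 1 - ·)

/-- The set with given particles and holes with respect to `range n`. -/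
def ofParticlesHoles (n : ℕ) (A B : Finset ℕ) : Finset ℕ :=
  A.image (· + n) ∪ (range n \ B.image (n - 1 - ·))

theorem mem_particles {n x : ℕ} {S : Finset ℕ} : x ∈ particles n S ↔ x + n ∈ S := by
  simp only [particles, mem_image, mem_filter]
  constructor
  · rintro ⟨y, ⟨hy, hny⟩, rfl⟩
    rwa [Nat.sub_add_cancel hny]
  · exact fun h => ⟨x + n, ⟨h, by omega⟩, by omega⟩

theorem mem_holes {n x : ℕ} {S : Finset ℕ} : x ∈ holes n S ↔ x < n ∧ n - 1 - x ∉ S := by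
  simp only [holes, mem_image, mem_sdiff, mem_range]
  constructor
  · rintro ⟨y, ⟨hy, hyS⟩, rfl⟩
    refine ⟨by omega, ?_⟩
    rwa [show n - 1 - (n - 1 - y) = y by omega]
  · exact fun ⟨h, hS⟩ => ⟨n - 1 - x, ⟨by omega, hS⟩, by omega⟩

theorem ofParticlesHoles_particles_holes (n : ℕ) (S : Finset ℕ) :
    ofParticlesHoles n (particles n S) (holes n S) = S := by
  ext x
  simp only [ofParticlesHoles, mem_union, mem_image, mem_sdiff, mem_range, mem_particles,
    mem_holes]
  constructor
  · rintro (⟨y, hy, rfl⟩ | ⟨hx, h⟩)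
    · exact hy
    · by_contra hxS
      exact h ⟨n - 1 - x, ⟨by omega, by rwa [show n - 1 - (n - 1 - x) = x by omega]⟩, by omega⟩
  · intro hx
    rcases lt_or_ge x n with hxn | hxn
    · refine Or.inr ⟨hxn, ?_⟩
      rintro ⟨y, ⟨hy, hyS⟩, rfl⟩
      exact hyS hx
    · exact Or.inl ⟨x - n, by rwa [Nat.sub_add_cancel hxn], by omega⟩

theorem particles_ofParticlesHoles (n : ℕ) (A B : Finset ℕ) :
    particles n (ofParticlesHoles n A B) = A := by
  ext x
  simp [mem_particles, ofParticlesHoles]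

theorem holes_ofParticlesHoles {n : ℕ} (A : Finset ℕ) {B : Finset ℕ} (hB : ∀ x ∈ B, x < n) :
    holes n (ofParticlesHoles n A B) = B := by
  ext x
  simp only [mem_holes, ofParticlesHoles, mem_union, mem_image, mem_sdiff, mem_range, not_or,
    not_and, not_not]
  constructor
  · rintro ⟨hx, -, h⟩
    obtain ⟨y, hy, hyx⟩ := h (by omega)
    have := hB y hy
    rwa [show x = y by omega]
  · intro hx
    have := hB x hx
    exact ⟨this, by rintro ⟨y, -, hy⟩; omega, fun _ => ⟨x, hx, rfl⟩⟩

theorem card_particles (n : ℕ) (S : Finset ℕ) :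
    (particles n S).card = {x ∈ S | n ≤ x}.card :=
  card_image_of_injOn fun x hx y hy h => by
    simp only [coe_filter, Set.mem_ofPred_eq] at hx hy h
    omega

theorem card_holes (n : ℕ) (S : Finset ℕ) : (holes n S).card = (range n \ S).card :=
  card_image_of_injOn fun x hx y hy h => by
    simp only [coe_sdiff, coe_range, Set.mem_sdiff, Set.mem_Iio] at hx hy h
    omega

theorem filter_not_le_eq_range_inter (n : ℕ) (S : Finset ℕ) :
    {x ∈ S | ¬ n ≤ x} = range n ∩ S := by
  ext x
  simp [and_comm]

theorem card_add_card_holes (n : ℕ) (S : Finset ℕ) :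
    S.card + (holes n S).card = n + (particles n S).card := by
  have h1 := card_filter_add_card_filter_not (s := S) (n ≤ ·)
  have h2 := card_sdiff_add_card_inter (range n) S
  rw [filter_not_le_eq_range_inter] at h1
  rw [card_range] at h2
  rw [card_particles, card_holes]
  omega

theorem sum_add_card_holes_mul (n : ℕ) (S : Finset ℕ) :
    ∑ x ∈ S, x + (holes n S).card * n =
      ∑ i ∈ range n, i + ∑ x ∈ particles n S, x + (particles n S).card * n +
        (holes n S).card + ∑ x ∈ holes n S, x := by
  have h1 := sum_filter_add_sum_filter_not S (n ≤ ·) (fun x => x)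
  have h2 := sum_inter_add_sum_sdiff (range n) S (fun x => x)
  have h3 : ∑ x ∈ S with n ≤ x, x = ∑ x ∈ particles n S, x + (particles n S).card * n := by
    rw [card_particles, particles, sum_image, ← smul_eq_mul, ← sum_const, ← sum_add_distrib]
    · exact sum_congr rfl fun x hx => (Nat.sub_add_cancel (mem_filter.1 hx).2).symm
    · intro x hx y hy h
      simp only [coe_filter, Set.mem_ofPred_eq] at hx hy h
      omega
  have h4 : ∑ x ∈ holes n S, x + (holes n S).card + ∑ x ∈ range n \ S, x =
      (holes n S).card * n := by
    rw [card_holes, holes, sum_image, ← smul_eq_mul, ← sum_const, card_eq_sum_ones,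
      ← sum_add_distrib, ← sum_add_distrib]
    · refine sum_congr rfl fun x hx => ?_
      have := mem_range.1 (mem_sdiff.1 hx).1
      omega
    · intro x hx y hy h
      simp only [coe_sdiff, coe_range, Set.mem_sdiff, Set.mem_Iio] at hx hy h
      omega
  rw [filter_not_le_eq_range_inter] at h1
  omega

theorem mem_finsetsCardSum_iff_particles_holes {n : ℕ} {S : Finset ℕ} :
    S ∈ finsetsCardSum n (n + ∑ i ∈ range n, i) ↔
      (holes n S).card = (particles n S).card ∧
        (particles n S).card + ∑ x ∈ particles n S, x + ∑ x ∈ holes n S, x = n := by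
  have h1 := card_add_card_holes n S
  have h2 := sum_add_card_holes_mul n S
  rw [mem_finsetsCardSum]
  constructor
  · rintro ⟨hc, hs⟩
    have hcard : (holes n S).card = (particles n S).card := by omega
    rw [hcard] at h2
    omega
  · rintro ⟨hcard, hs⟩
    rw [hcard] at h2
    omega

theorem lt_of_card_add_sum_le {n : ℕ} {B : Finset ℕ} (h : B.card + ∑ x ∈ B, x ≤ n) :
    ∀ x ∈ B, x < n := fun x hx => by
  have h1 : x ≤ ∑ x ∈ B, x := single_le_sum (f := fun x => x) (by simp) hx
  have h2 := card_pos.2 ⟨x, hx⟩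
  omega

theorem card_finsetsCardSum_eq_sum (n : ℕ) :
    (finsetsCardSum n (n + ∑ i ∈ range n, i)).card =
      ∑ l ∈ range (n + 1), ∑ k ∈ range (l + 1),
        (finsetsCardSum k (l - k)).card * (finsetsCardSum k (n - l)).card := by
  simp_rw [← card_product, ← card_sigma]
  refine card_bij' (fun S _ => ⟨(particles n S).card + ∑ x ∈ particles n S, x,
      (particles n S).card, particles n S, holes n S⟩)
    (fun p _ => ofParticlesHoles n p.2.2.1 p.2.2.2) ?_ ?_ ?_ ?_
  · intro S hS
    obtain ⟨h1, h2⟩ := mem_finsetsCardSum_iff_particles_holes.1 hS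
    simp only [mem_sigma, mem_range, mem_product, mem_finsetsCardSum, h1, true_and]
    omega
  · rintro ⟨l, k, A, B⟩ h
    obtain ⟨hl, hk, hA, hA', hB, hB'⟩ := by
      simpa only [mem_sigma, mem_range, mem_product, mem_finsetsCardSum, and_assoc] using h
    have hBn := lt_of_card_add_sum_le (n := n) (B := B) (by omega)
    rw [mem_finsetsCardSum_iff_particles_holes, particles_ofParticlesHoles,
      holes_ofParticlesHoles A hBn]
    simp only [hA, hB, true_and] at hA' hB' ⊢
    omega
  · exact fun S _ => ofParticlesHoles_particles_holes n S
  · rintro ⟨l, k, A, B⟩ h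
    obtain ⟨hl, hk, hA, hA', hB, hB'⟩ := by
      simpa only [mem_sigma, mem_range, mem_product, mem_finsetsCardSum, and_assoc] using h
    have hBn := lt_of_card_add_sum_le (n := n) (B := B) (by omega)
    simp only [particles_ofParticlesHoles, holes_ofParticlesHoles A hBn, hA, hA',
      Nat.add_sub_cancel' (Nat.le_of_lt_succ hk)]

theorem partition_eq_sum_card_B_mul_card_B (n : ℕ) :
    Fintype.card (Nat.Partition n) =
      ∑ l ∈ Finset.range (n + 1), ∑ k ∈ Finset.range (l + 1),
        Nat.card (setB k ((l : ℤ) - k)) * Nat.card (setB k ((n : ℤ) - l)) := by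
  rw [card_partition_eq_card_finsetsCardSum, card_finsetsCardSum_eq_sum]
  refine sum_congr rfl fun l hl => sum_congr rfl fun k hk => ?_
  rw [mem_range, Nat.lt_succ_iff] at hl hk
  rw [← Nat.cast_sub hl, ← Nat.cast_sub hk, card_setB_eq_card_finsetsCardSum,
    card_setB_eq_card_finsetsCardSum]
end

section
/- For every natural number n, there is a bijection between the set of partitions of n and the disjoint union, over all pairs (k,l) with 0 ≤ k ≤ l ≤ n, of the products A(k,l) × B(k,n-l), where A(k,l) = {(x_1,…,x_k) ∈ ℤ^k : 1 ≤ x_1 < ⋯ < x_k, x_1 + ⋯ + x_k = l} and B(k,l) = {(x_1,…,x_k) ∈ ℤ^k : 0 ≤ x_1 < ⋯ < x_k, x_1 + ⋯ + x_k = l}. -/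
open Finset in
/-- Strictly increasing `k`-tuples of integers at least `c` with sum `l` correspond to `k`-element
finite sets of integers with the same lower bound and sum. -/
noncomputable def strictMonoTupleEquivFinset (k : ℕ) (c l : ℤ) :
    {x : Fin k → ℤ // StrictMono x ∧ (∀ i, c ≤ x i) ∧ ∑ i, x i = l} ≃
      {U : Finset ℤ // U.card = k ∧ (∀ u ∈ U, c ≤ u) ∧ ∑ u ∈ U, u = l} where
  toFun x := ⟨univ.image x.1, by
    obtain ⟨x, hx, hc, hl⟩ := x
    refine ⟨by simp [card_image_of_injective _ hx.injective], by simpa using hc, ?_⟩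
    rw [sum_image fun _ _ _ _ h => hx.injective h, hl]⟩
  invFun U := ⟨U.1.orderEmbOfFin U.2.1, by
    obtain ⟨U, hk, hc, hl⟩ := U
    refine ⟨(U.orderEmbOfFin hk).strictMono, fun i => hc _ (orderEmbOfFin_mem _ _ _), ?_⟩
    conv_rhs => rw [← hl, ← image_orderEmbOfFin_univ U hk]
    rw [sum_image fun _ _ _ _ h => (U.orderEmbOfFin hk).injective h]⟩
  left_inv := fun ⟨x, hx, _⟩ => Subtype.ext
    (orderEmbOfFin_unique _ (fun i => mem_image_of_mem _ (mem_univ i)) hx).symm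
  right_inv := fun ⟨U, hk, _⟩ => Subtype.ext (image_orderEmbOfFin_univ U hk)

theorem Monotone.eq_of_multiset_map_eq {α : Type*} [LinearOrder α] {n : ℕ} {f g : Fin n → α}
    (hf : Monotone f) (hg : Monotone g)
    (h : Finset.univ.val.map f = Finset.univ.val.map g) : f = g := by
  simp only [Fin.univ_val_map, Multiset.coe_eq_coe] at h
  exact List.ofFn_injective
    (h.eq_of_pairwise' hf.sortedLE_ofFn.pairwise hg.sortedLE_ofFn.pairwise)

theorem Multiset.exists_monotone_map_univ_eq {α : Type*} [LinearOrder α] {n : ℕ}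
    (s : Multiset α) (hs : s.card = n) :
    ∃ f : Fin n → α, Monotone f ∧ Finset.univ.val.map f = s := by
  subst hs
  have hlen : (s.sort (· ≤ ·)).length = s.card := Multiset.length_sort _
  refine ⟨fun i => (s.sort (· ≤ ·)).get (i.cast hlen.symm), ?_, ?_⟩
  · intro i j hij
    exact (Multiset.pairwise_sort s (· ≤ ·)).sortedLE.monotone_get (by simpa using hij)
  · rw [Fin.univ_val_map]
    conv_rhs => rw [← Multiset.sort_eq s (· ≤ ·)]
    congr 1
    apply List.ext_get <;> simp

theorem Multiset.eq_of_filter_ne_eq_of_card_eq {α : Type*} [DecidableEq α] {a : α}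
    {s t : Multiset α} (h : s.filter (· ≠ a) = t.filter (· ≠ a)) (hc : s.card = t.card) :
    s = t := by
  have hs := Multiset.filter_add_not (· = a) s
  have ht := Multiset.filter_add_not (· = a) t
  rw [Multiset.filter_eq'] at hs ht
  have hs' := congrArg Multiset.card hs
  have ht' := congrArg Multiset.card ht
  simp only [Multiset.card_add, Multiset.card_replicate] at hs' ht'
  simp only [ne_eq] at h
  rw [h] at hs hs'
  rw [show s.count a = t.count a by omega] at hs
  exact hs.symm.trans ht

theorem Nat.Partition.card_parts_le {n : ℕ} (p : n.Partition) : p.parts.card ≤ n := by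
  have := Multiset.card_nsmul_le_sum (s := p.parts) (a := 1) fun x hx => p.parts_pos hx
  simpa [p.parts_sum] using this

/-- Partitions of `n` are monotone `n`-tuples of natural numbers with sum `n`, obtained by padding
with zeros. -/
noncomputable def monotoneTupleEquivPartition (n : ℕ) :
    {f : Fin n → ℕ // Monotone f ∧ ∑ i, f i = n} ≃ n.Partition :=
  Equiv.ofBijective (fun f => Nat.Partition.ofSums n (Finset.univ.val.map f.1) f.2.2) <| by
    constructor
    · rintro ⟨f, hf, hfn⟩ ⟨g, hg, hgn⟩ h
      have h' := congrArg Nat.Partition.parts h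
      exact Subtype.ext <| hf.eq_of_multiset_map_eq hg <|
        Multiset.eq_of_filter_ne_eq_of_card_eq (a := 0) h' (by simp)
    · intro p
      obtain ⟨f, hf, hs⟩ := Multiset.exists_monotone_map_univ_eq (n := n)
        (p.parts + Multiset.replicate (n - p.parts.card) 0)
        (by simpa using Nat.add_sub_cancel' p.card_parts_le)
      refine ⟨⟨f, hf, ?_⟩, ?_⟩
      · rw [Finset.sum, hs]
        simp [p.parts_sum]
      · ext1
        simp only [Nat.Partition.ofSums_parts, hs, Multiset.filter_add]
        rw [Multiset.filter_eq_self.2 fun a ha => (p.parts_pos ha).ne',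
          Multiset.filter_eq_nil.2 fun a ha => by simpa using Multiset.eq_of_mem_replicate ha]
        simp

theorem StrictMono.monotone_sub_val {n : ℕ} {x : Fin n → ℤ} (hx : StrictMono x) :
    Monotone fun i : Fin n => x i - (i : ℤ) := by
  cases n with
  | zero => exact fun i => i.elim0
  | succ n =>
    refine Fin.monotone_iff_le_succ.2 fun i => ?_
    have := hx (Fin.castSucc_lt_succ (i := i))
    simp only [Fin.val_castSucc, Fin.val_succ]
    push_cast
    omega

theorem StrictMono.add_val_le {n : ℕ} {x : Fin n → ℤ} (hx : StrictMono x) {c : ℤ}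
    (hc : ∀ i, c ≤ x i) (i : Fin n) : c + i ≤ x i := by
  have h0 : (⟨0, i.pos⟩ : Fin n) ≤ i := Nat.zero_le _
  have h1 := hx.monotone_sub_val h0
  have h2 := hc ⟨0, i.pos⟩
  simp only [Nat.cast_zero] at h1
  omega

open Finset in
/-- Adding the staircase `-n, …, -1` turns monotone tuples into strictly monotone ones. -/
def monotoneTupleEquivStrictMonoTuple (n : ℕ) :
    {f : Fin n → ℕ // Monotone f ∧ ∑ i, f i = n} ≃
      {x : Fin n → ℤ // StrictMono x ∧ (∀ i, -(n : ℤ) ≤ x i) ∧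
        ∑ i, x i = n + ∑ i : Fin n, ((i : ℤ) - n)} where
  toFun f := ⟨fun i => f.1 i + ((i : ℤ) - n), by
    obtain ⟨f, hf, hs⟩ := f
    refine ⟨fun i j hij => ?_, fun i => ?_, ?_⟩
    · have := hf hij.le
      have : (i : ℕ) < j := hij
      dsimp only
      omega
    · dsimp only
      omega
    · rw [sum_add_distrib]
      exact_mod_cast congrArg (fun m : ℕ => (m : ℤ) + ∑ i : Fin n, ((i : ℤ) - n)) hs⟩
  invFun x := ⟨fun i => (x.1 i - ((i : ℤ) - n)).toNat, by
    obtain ⟨x, hx, hc, hs⟩ := x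
    constructor
    · intro i j hij
      have := hx.monotone_sub_val hij
      dsimp only at this ⊢
      omega
    · have hnonneg : ∀ i : Fin n, 0 ≤ x i - ((i : ℤ) - n) := fun i => by
        have := hx.add_val_le hc i
        omega
      zify
      rw [sum_congr rfl fun i _ => Int.toNat_of_nonneg (hnonneg i), sum_sub_distrib, hs]
      ring⟩
  left_inv f := by ext; simp
  right_inv := by
    rintro ⟨x, hx, hc, hs⟩
    ext i
    have := hx.add_val_le hc i
    dsimp only
    omega

theorem Int.sum_Ico_neg_zero (n : ℕ) :
    ∑ i ∈ Finset.Ico (-(n : ℤ)) 0, i = ∑ i : Fin n, ((i : ℤ) - n) := by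
  symm
  refine Finset.sum_bij (fun i _ => (i : ℤ) - n) (fun i _ => ?_) (fun i _ j _ h => ?_)
    (fun b hb => ?_) fun _ _ => rfl
  · simp only [Finset.mem_Ico]
    omega
  · omega
  · rw [Finset.mem_Ico] at hb
    exact ⟨⟨(b + n).toNat, by omega⟩, Finset.mem_univ _, by simp only; omega⟩

/-- The absolute values of the elements of `[-n, -1]` missing from `U`. -/
noncomputable def negHoles (n : ℕ) (U : Finset ℤ) : Finset ℤ :=
  (Finset.Ico (-(n : ℤ)) 0 \ U).image Neg.neg

theorem mem_negHoles {n : ℕ} {U : Finset ℤ} {t : ℤ} :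
    t ∈ negHoles n U ↔ 1 ≤ t ∧ t ≤ n ∧ -t ∉ U := by
  simp only [negHoles, Finset.mem_image, Finset.mem_sdiff, Finset.mem_Ico]
  constructor
  · rintro ⟨a, ⟨⟨h1, h2⟩, h3⟩, rfl⟩
    exact ⟨by omega, by omega, by simpa using h3⟩
  · rintro ⟨h1, h2, h3⟩
    exact ⟨-t, ⟨by omega, h3⟩, by simp⟩

theorem Finset.sum_Ico_neg_zero_eq_add_sum_sdiff {M : Type*} [AddCommMonoid M] {n : ℕ}
    {U : Finset ℤ} (hU : ∀ u ∈ U, -(n : ℤ) ≤ u) (f : ℤ → M) :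
    ∑ u ∈ Ico (-(n : ℤ)) 0 \ U, f u + ∑ u ∈ U, f u =
      ∑ u ∈ Ico (-(n : ℤ)) 0, f u + ∑ u ∈ U with 0 ≤ u, f u := by
  have h : U.filter (¬ 0 ≤ ·) = Ico (-(n : ℤ)) 0 ∩ U := by
    ext u
    simp only [mem_filter, mem_inter, mem_Ico]
    constructor
    · rintro ⟨h1, h2⟩
      exact ⟨⟨hU u h1, by omega⟩, h1⟩
    · rintro ⟨h1, h2⟩
      exact ⟨h2, by omega⟩
  rw [← sum_filter_not_add_sum_filter U (0 ≤ ·), h, ← add_assoc,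
    add_comm (∑ u ∈ Ico (-(n : ℤ)) 0 \ U, f u), sum_inter_add_sum_sdiff]

theorem card_negHoles_add_card {n : ℕ} {U : Finset ℤ} (hU : ∀ u ∈ U, -(n : ℤ) ≤ u) :
    (negHoles n U).card + U.card = n + (U.filter (0 ≤ ·)).card := by
  have := Finset.sum_Ico_neg_zero_eq_add_sum_sdiff hU fun _ => 1
  rw [negHoles, Finset.card_image_of_injective _ neg_injective]
  simpa using this

theorem sum_eq_add_sum_negHoles {n : ℕ} {U : Finset ℤ} (hU : ∀ u ∈ U, -(n : ℤ) ≤ u) :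
    ∑ u ∈ U, u = ∑ i : Fin n, ((i : ℤ) - n) +
      (∑ t ∈ negHoles n U, t + ∑ s ∈ U with 0 ≤ s, s) := by
  have := Finset.sum_Ico_neg_zero_eq_add_sum_sdiff hU fun u => u
  rw [negHoles, Finset.sum_image neg_injective.injOn, Finset.sum_neg_distrib,
    ← Int.sum_Ico_neg_zero]
  linarith

/-- The set with nonnegative part `S` whose holes in `[-n, -1]` are the negatives of `T`. -/
noncomputable def ofNegHoles (n : ℕ) (T S : Finset ℤ) : Finset ℤ :=
  S ∪ (Finset.Ico (-(n : ℤ)) 0).filter (- · ∉ T)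

theorem mem_ofNegHoles {n : ℕ} {T S : Finset ℤ} {u : ℤ} :
    u ∈ ofNegHoles n T S ↔ u ∈ S ∨ (-(n : ℤ) ≤ u ∧ u < 0) ∧ -u ∉ T := by
  simp [ofNegHoles]

theorem le_of_mem_ofNegHoles {n : ℕ} {T S : Finset ℤ} (hS : ∀ s ∈ S, 0 ≤ s) {u : ℤ}
    (hu : u ∈ ofNegHoles n T S) : -(n : ℤ) ≤ u := by
  rcases mem_ofNegHoles.1 hu with h | h
  · have := hS u h
    omega
  · exact h.1.1

theorem filter_ofNegHoles {n : ℕ} {T S : Finset ℤ} (hS : ∀ s ∈ S, 0 ≤ s) :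
    (ofNegHoles n T S).filter (0 ≤ ·) = S := by
  ext u
  rw [Finset.mem_filter, mem_ofNegHoles]
  constructor
  · rintro ⟨h | h, h0⟩
    · exact h
    · omega
  · exact fun h => ⟨Or.inl h, hS u h⟩

theorem negHoles_ofNegHoles {n : ℕ} {T S : Finset ℤ} (hT : ∀ t ∈ T, 1 ≤ t ∧ t ≤ n)
    (hS : ∀ s ∈ S, 0 ≤ s) : negHoles n (ofNegHoles n T S) = T := by
  ext t
  rw [mem_negHoles, mem_ofNegHoles, neg_neg]
  constructor
  · rintro ⟨h1, h2, h3⟩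
    by_contra h
    exact h3 (Or.inr ⟨by omega, h⟩)
  · intro h
    refine ⟨(hT t h).1, (hT t h).2, ?_⟩
    rintro (h' | h')
    · have := hS _ h'
      have := (hT t h).1
      omega
    · exact h'.2 h

theorem ofNegHoles_negHoles {n : ℕ} {U : Finset ℤ} (hU : ∀ u ∈ U, -(n : ℤ) ≤ u) :
    ofNegHoles n (negHoles n U) (U.filter (0 ≤ ·)) = U := by
  ext u
  rw [mem_ofNegHoles, mem_negHoles, neg_neg, Finset.mem_filter]
  constructor
  · rintro (h | ⟨h1, h2⟩)
    · exact h.1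
    · by_contra h
      exact h2 ⟨by omega, by omega, h⟩
  · intro h
    have := hU u h
    by_cases h0 : 0 ≤ u
    · exact Or.inl ⟨h, h0⟩
    · exact Or.inr ⟨by omega, fun h' => h'.2.2 h⟩

theorem le_of_mem_of_sum_add_sum_eq {n : ℤ} {T S : Finset ℤ} (hT : ∀ t ∈ T, 1 ≤ t)
    (hS : ∀ s ∈ S, 0 ≤ s) (h : ∑ t ∈ T, t + ∑ s ∈ S, s = n) {t : ℤ} (ht : t ∈ T) : t ≤ n := by
  have h1 := Finset.single_le_sum (f := fun t : ℤ => t)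
    (fun t ht => zero_le_one.trans (hT t ht)) ht
  have h2 := Finset.sum_nonneg hS
  linarith

/-- Splitting a finite set of integers at `0` and replacing its negative part by the complement of
that part in `[-n, -1]`, reflected. -/
noncomputable def finsetEquivFinsetPair (n : ℕ) :
    {U : Finset ℤ // U.card = n ∧ (∀ u ∈ U, -(n : ℤ) ≤ u) ∧
        ∑ u ∈ U, u = n + ∑ i : Fin n, ((i : ℤ) - n)} ≃
      {p : Finset ℤ × Finset ℤ // p.1.card = p.2.card ∧ (∀ t ∈ p.1, 1 ≤ t) ∧ (∀ s ∈ p.2, 0 ≤ s) ∧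
        ∑ t ∈ p.1, t + ∑ s ∈ p.2, s = n} where
  toFun U := ⟨(negHoles n U.1, U.1.filter (0 ≤ ·)), by
    obtain ⟨U, hn, hU, hs⟩ := U
    have h1 := card_negHoles_add_card hU
    have h2 := sum_eq_add_sum_negHoles hU
    refine ⟨?_, fun t ht => (mem_negHoles.1 ht).1, fun s hs => (Finset.mem_filter.1 hs).2, ?_⟩
    · dsimp only
      omega
    · dsimp only
      linarith⟩
  invFun p := ⟨ofNegHoles n p.1.1 p.1.2, by
    obtain ⟨⟨T, S⟩, hc, hT, hS, hs⟩ := p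
    dsimp only at hc hT hS hs ⊢
    have hT' : ∀ t ∈ T, 1 ≤ t ∧ t ≤ n := fun t ht =>
      ⟨hT t ht, le_of_mem_of_sum_add_sum_eq hT hS hs ht⟩
    have hU : ∀ u ∈ ofNegHoles n T S, -(n : ℤ) ≤ u := fun u => le_of_mem_ofNegHoles hS
    have h1 := card_negHoles_add_card hU
    have h2 := sum_eq_add_sum_negHoles hU
    rw [negHoles_ofNegHoles hT' hS, filter_ofNegHoles hS] at h1 h2
    exact ⟨by omega, hU, by linarith⟩⟩
  left_inv := fun ⟨_, _, hU, _⟩ => Subtype.ext (ofNegHoles_negHoles hU)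
  right_inv := fun ⟨_, _, hT, hS, hs⟩ => Subtype.ext <| Prod.ext
    (negHoles_ofNegHoles (fun t ht => ⟨hT t ht, le_of_mem_of_sum_add_sum_eq hT hS hs ht⟩) hS)
    (filter_ofNegHoles hS)

/-- Pairs of finite sets of equal size, sorted by that size and by the sum of the first set. -/
noncomputable def finsetPairEquivSigma (n : ℕ) :
    {p : Finset ℤ × Finset ℤ // p.1.card = p.2.card ∧ (∀ t ∈ p.1, 1 ≤ t) ∧
        (∀ s ∈ p.2, 0 ≤ s) ∧ ∑ t ∈ p.1, t + ∑ s ∈ p.2, s = n} ≃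
      Σ kl : {p : ℕ × ℕ // p.1 ≤ p.2 ∧ p.2 ≤ n},
        setA kl.1.1 (kl.1.2 : ℤ) × setB kl.1.1 ((n : ℤ) - kl.1.2) :=
  (Equiv.sigmaFiberEquiv fun p =>
    (⟨(p.1.1.card, (∑ t ∈ p.1.1, t).toNat), by
      obtain ⟨⟨T, S⟩, hc, hT, hS, hs⟩ := p
      have h1 := Finset.card_nsmul_le_sum T (fun t => t) 1 hT
      have h2 := Finset.sum_nonneg hS
      simp only [nsmul_eq_mul, mul_one] at h1 h2 hs ⊢
      omega⟩ : {p : ℕ × ℕ // p.1 ≤ p.2 ∧ p.2 ≤ n})).symm.trans <|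
  Equiv.sigmaCongrRight fun kl =>
    Equiv.trans
      { toFun := fun p => (⟨p.1.1.1, by
          obtain ⟨⟨⟨T, S⟩, hc, hT, hS, hs⟩, rfl⟩ := p
          have := Finset.sum_nonneg fun t ht => zero_le_one.trans (hT t ht)
          exact ⟨rfl, hT, (Int.toNat_of_nonneg this).symm⟩⟩, ⟨p.1.1.2, by
          obtain ⟨⟨⟨T, S⟩, hc, hT, hS, hs⟩, rfl⟩ := p
          have := Finset.sum_nonneg fun t ht => zero_le_one.trans (hT t ht)
          refine ⟨hc.symm, hS, ?_⟩
          dsimp only at this hs ⊢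
          omega⟩)
        invFun := fun q => ⟨⟨(q.1.1, q.2.1), by
          obtain ⟨⟨T, hT, hT1, hTs⟩, ⟨S, hS, hS0, hSs⟩⟩ := q
          exact ⟨hT.trans hS.symm, hT1, hS0, by simp only [hTs, hSs]; ring⟩⟩, by
          obtain ⟨⟨T, hT, hT1, hTs⟩, ⟨S, hS, hS0, hSs⟩⟩ := q
          ext
          · exact hT
          · simp [hTs]⟩
        left_inv := fun _ => rfl
        right_inv := fun _ => rfl }
      (Equiv.prodCongr (strictMonoTupleEquivFinset kl.1.1 1 kl.1.2).symm
        (strictMonoTupleEquivFinset kl.1.1 0 (n - kl.1.2)).symm)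

theorem partitions_equiv_sigma_A_times_B (n : ℕ) :
    Nonempty (Nat.Partition n ≃
      Σ kl : {p : ℕ × ℕ // p.1 ≤ p.2 ∧ p.2 ≤ n},
        setA kl.1.1 (kl.1.2 : ℤ) × setB kl.1.1 ((n : ℤ) - kl.1.2)) := by
  exact ⟨(monotoneTupleEquivPartition n).symm.trans <|
    (monotoneTupleEquivStrictMonoTuple n).trans <|
    (strictMonoTupleEquivFinset n _ _).trans <|
    (finsetEquivFinsetPair n).trans (finsetPairEquivSigma n)⟩
end

section
/- Let q be a prime, let 1 ≤ e_1 < ⋯ < e_k be integers and n_1,…,n_k > 0, and let A = A_1 ⊕ ⋯ ⊕ A_k where A_i = (ℤ/q^{e_i}ℤ)^{n_i}. For each i choose ε_i ∈ A_i \ qA_i. Then for every x ∈ A there exist an automorphism σ of A and a sequence (i_1,f_1),…,(i_l,f_l) ∈ I(e_1,…,e_k) such that σ(x) = Σ_{s=1}^{l} q^{f_s} ε_{i_s} (viewing each A_{i_s} as a subgroup of A). -/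
/-- `I(e₁,…,e_k)`: the set of (possibly empty) sequences of pairs `(i₁,f₁),…,(i_l,f_l)`
with `i₁ < ⋯ < i_l` in `Fin k`, `0 ≤ f_s ≤ e_{i_s} - 1`, and
`0 < f_{s+1} - f_s < e_{i_{s+1}} - e_{i_s}` for consecutive pairs. -/
def GalkinI (k : ℕ) (e : Fin k → ℕ) : Set (List (Fin k × ℕ)) :=
  {l | (∀ p ∈ l, p.2 < e p.1) ∧
    l.Chain' (fun a b => a.1 < b.1 ∧ a.2 < b.2 ∧ b.2 + e a.1 < a.2 + e b.1)}

/-- The element `∑_s q^{f_s} ε_{i_s}` of `A = ⊕ᵢ (ℤ/q^{eᵢ}ℤ)^{nᵢ}` associated to a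
sequence `(i₁,f₁),…,(i_l,f_l)`, viewing each `A_i` as a subgroup of `A`. -/
def galkinElem (q k : ℕ) (e m : Fin k → ℕ)
    (ε : (i : Fin k) → Fin (m i) → ZMod (q ^ e i)) (l : List (Fin k × ℕ)) :
    (i : Fin k) → Fin (m i) → ZMod (q ^ e i) :=
  (l.map fun p => Pi.single p.1 ((q ^ p.2) • ε p.1)).sum

theorem ZMod.isUnit_or_exists_prime_mul {q e : ℕ} (hq : q.Prime) (a : ZMod (q ^ e)) :
    IsUnit a ∨ ∃ b, (q : ZMod (q ^ e)) * b = a := by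
  have : NeZero (q ^ e) := ⟨pow_ne_zero _ hq.ne_zero⟩
  rw [← ZMod.natCast_zmod_val a]
  by_cases h : q ∣ a.val
  · obtain ⟨c, hc⟩ := h
    exact .inr ⟨c, by rw [hc]; push_cast; rfl⟩
  · refine .inl ((ZMod.isUnit_iff_coprime _ _).2 ?_)
    exact (((Nat.Prime.coprime_iff_not_dvd hq).2 h).symm).pow_right e

theorem ZMod.isUnit_add_of_not_isUnit {q e : ℕ} (hq : q.Prime) {a b : ZMod (q ^ e)}
    (ha : IsUnit a) (hb : ¬IsUnit b) : IsUnit (a + b) := by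
  obtain ⟨c, rfl⟩ := (ZMod.isUnit_or_exists_prime_mul hq b).resolve_left hb
  refine IsNilpotent.isUnit_add_left_of_commute ⟨e, ?_⟩ ha (Commute.all _ _)
  rw [mul_pow, ← Nat.cast_pow, ZMod.natCast_self, zero_mul]

theorem exists_isUnit_apply_of_not_divisible {q e n : ℕ} (hq : q.Prime)
    {y : Fin n → ZMod (q ^ e)} (hy : ¬∃ z : Fin n → ZMod (q ^ e), q • z = y) :
    ∃ c, IsUnit (y c) := by
  by_contra! h
  choose z hz using fun c => (ZMod.isUnit_or_exists_prime_mul hq (y c)).resolve_left (h c)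
  exact hy ⟨z, funext fun c => by simpa using hz c⟩

/-- A non-divisible element of `(ℤ/q^eℤ)^n` can be sent to any element killed by `q^e`. -/
theorem exists_addMonoidHom_apply_eq {q e n : ℕ} (hq : q.Prime)
    {y : Fin n → ZMod (q ^ e)} (hy : ¬∃ z : Fin n → ZMod (q ^ e), q • z = y)
    {B : Type*} [AddCommGroup B] (v : B) (hv : (q ^ e) • v = 0) :
    ∃ ψ : (Fin n → ZMod (q ^ e)) →+ B, ψ y = v := by
  obtain ⟨c, u, hu⟩ := exists_isUnit_apply_of_not_divisible hq hy
  let g : ZMod (q ^ e) →+ B := ZMod.lift (q ^ e) ⟨zmultiplesHom B v, by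
    rw [zmultiplesHom_apply, natCast_zsmul, hv]⟩
  refine ⟨(g.comp (AddMonoidHom.mulLeft (↑u⁻¹ : ZMod (q ^ e)))).comp
    (Pi.evalAddMonoidHom _ c), ?_⟩
  have h1 : g 1 = v := by
    have := ZMod.lift_coe (q ^ e) ⟨zmultiplesHom B v, by
      rw [zmultiplesHom_apply, natCast_zsmul, hv]⟩ 1
    simpa [g] using this
  simp [← hu, h1]

/-- Two non-divisible elements of `(ℤ/q^eℤ)^n` have a common functional taking unit values. -/
theorem exists_linearMap_isUnit_isUnit {q e n : ℕ} (hq : q.Prime)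
    {y z : Fin n → ZMod (q ^ e)} (hy : ¬∃ w : Fin n → ZMod (q ^ e), q • w = y)
    (hz : ¬∃ w : Fin n → ZMod (q ^ e), q • w = z) :
    ∃ l : (Fin n → ZMod (q ^ e)) →ₗ[ZMod (q ^ e)] ZMod (q ^ e), IsUnit (l y) ∧ IsUnit (l z) := by
  obtain ⟨c, hc⟩ := exists_isUnit_apply_of_not_divisible hq hy
  obtain ⟨d, hd⟩ := exists_isUnit_apply_of_not_divisible hq hz
  by_cases h1 : IsUnit (z c)
  · exact ⟨LinearMap.proj c, hc, h1⟩
  by_cases h2 : IsUnit (y d)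
  · exact ⟨LinearMap.proj d, h2, hd⟩
  refine ⟨LinearMap.proj (R := ZMod (q ^ e)) (φ := fun _ => ZMod (q ^ e)) c +
    LinearMap.proj (R := ZMod (q ^ e)) (φ := fun _ => ZMod (q ^ e)) d, ?_, ?_⟩
  · rw [LinearMap.add_apply]
    exact ZMod.isUnit_add_of_not_isUnit hq hc h2
  · rw [LinearMap.add_apply, add_comm]
    exact ZMod.isUnit_add_of_not_isUnit hq hd h1

theorem exists_addAut_apply_eq_of_injective {B : Type*} [AddCommGroup B] [Finite B] (φ : B →+ B)
    (h : ∀ a, φ a = 0 → a = 0) : ∃ σ : AddAut B, ∀ a, σ a = φ a :=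
  ⟨AddEquiv.ofBijective φ (Finite.injective_iff_bijective.1 ((injective_iff_map_eq_zero φ).2 h)),
    fun _ => rfl⟩

theorem exists_addAut_apply_eq_of_not_divisible {q e n : ℕ} (hq : q.Prime)
    {y z : Fin n → ZMod (q ^ e)} (hy : ¬∃ w : Fin n → ZMod (q ^ e), q • w = y)
    (hz : ¬∃ w : Fin n → ZMod (q ^ e), q • w = z) :
    ∃ σ : AddAut (Fin n → ZMod (q ^ e)), σ y = z := by
  have : NeZero (q ^ e) := ⟨pow_ne_zero _ hq.ne_zero⟩
  obtain ⟨l, ⟨u, hu⟩, w, hw⟩ := exists_linearMap_isUnit_isUnit hq hy hz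
  let φ : (Fin n → ZMod (q ^ e)) →ₗ[ZMod (q ^ e)] (Fin n → ZMod (q ^ e)) :=
    LinearMap.id + l.smulRight ((↑u⁻¹ : ZMod (q ^ e)) • (z - y))
  have hφ : ∀ a, φ a = a + l a • (↑u⁻¹ : ZMod (q ^ e)) • (z - y) := fun _ => rfl
  obtain ⟨σ, hσ⟩ := exists_addAut_apply_eq_of_injective φ.toAddMonoidHom (fun a ha => by
    have ha' : a + l a • (↑u⁻¹ : ZMod (q ^ e)) • (z - y) = 0 := ha
    have h1 := congrArg l ha'
    rw [map_add, map_smul, map_smul, map_sub, ← hu, ← hw, map_zero, smul_eq_mul, smul_eq_mul,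
      mul_sub, Units.inv_mul] at h1
    have h2 : l a * ((u⁻¹ * w : (ZMod (q ^ e))ˣ) : ZMod (q ^ e)) = 0 := by
      rw [Units.val_mul, ← h1]; ring
    rw [Units.mul_left_eq_zero] at h2
    simpa [h2] using ha')
  refine ⟨σ, (hσ y).trans ?_⟩
  change φ y = z
  rw [hφ, ← hu, smul_smul, Units.mul_inv, one_smul, add_sub_cancel]

theorem exists_eq_pow_smul_of_not_divisible {q e n : ℕ} {ε : Fin n → ZMod (q ^ e)}
    (hε : ¬∃ w : Fin n → ZMod (q ^ e), q • w = ε) (x : Fin n → ZMod (q ^ e)) :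
    ∃ f ≤ e, ∃ y : Fin n → ZMod (q ^ e), (¬∃ w : Fin n → ZMod (q ^ e), q • w = y) ∧
      x = q ^ f • y := by
  classical
  let P : ℕ → Prop := fun f => ∃ y : Fin n → ZMod (q ^ e), x = q ^ f • y
  have h0 : P 0 := ⟨x, by simp⟩
  have hs : P (Nat.findGreatest P e) := Nat.findGreatest_spec (Nat.zero_le e) h0
  have hle := Nat.findGreatest_le (P := P) e
  rcases hle.lt_or_eq with h | h
  · obtain ⟨y, hy⟩ := hs
    refine ⟨_, hle, y, ?_, hy⟩
    rintro ⟨w, rfl⟩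
    refine Nat.findGreatest_is_greatest (Nat.lt_succ_self _) h ⟨w, ?_⟩
    rw [hy, smul_smul, Nat.succ_eq_add_one, pow_succ]
  · obtain ⟨y, hy⟩ := hs
    refine ⟨e, le_rfl, ε, hε, ?_⟩
    rw [hy, h, ← Nat.cast_smul_eq_nsmul (ZMod (q ^ e)) _ y,
      ← Nat.cast_smul_eq_nsmul (ZMod (q ^ e)) _ ε, ZMod.natCast_self, zero_smul, zero_smul]

theorem exists_addAut_apply_eq_pow_smul {q e n : ℕ} (hq : q.Prime) {ε : Fin n → ZMod (q ^ e)}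
    (hε : ¬∃ w : Fin n → ZMod (q ^ e), q • w = ε) (x : Fin n → ZMod (q ^ e)) :
    ∃ f ≤ e, ∃ σ : AddAut (Fin n → ZMod (q ^ e)), σ x = q ^ f • ε := by
  obtain ⟨f, hf, y, hy, rfl⟩ := exists_eq_pow_smul_of_not_divisible hε x
  obtain ⟨σ, hσ⟩ := exists_addAut_apply_eq_of_not_divisible hq hy hε
  exact ⟨f, hf, σ, by rw [map_nsmul, hσ]⟩

theorem pow_smul_eq_zero_of_le {q e n a : ℕ} (h : e ≤ a) (y : Fin n → ZMod (q ^ e)) :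
    q ^ a • y = 0 := by
  obtain ⟨b, rfl⟩ := Nat.exists_eq_add_of_le h
  rw [pow_add, mul_comm, mul_smul, ← Nat.cast_smul_eq_nsmul (ZMod (q ^ e)) (q ^ e) y,
    ZMod.natCast_self, zero_smul, smul_zero]

/-- The shear automorphism adding to the `i`-th coordinate a function of the `j`-th one. -/
theorem exists_addAut_shear {ι : Type*} [Finite ι] [DecidableEq ι] {B : ι → Type*}
    [∀ i, AddCommGroup (B i)] [∀ i, Finite (B i)] {i j : ι} (hij : i ≠ j) (ψ : B j →+ B i) :
    ∃ σ : AddAut (∀ i, B i), ∀ a, σ a = a + Pi.single i (ψ (a j)) := by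
  let φ : (∀ i, B i) →+ (∀ i, B i) := AddMonoidHom.id _ +
    (AddMonoidHom.single B i).comp (ψ.comp (Pi.evalAddMonoidHom B j))
  refine exists_addAut_apply_eq_of_injective φ fun a ha => ?_
  have ha' : a + Pi.single i (ψ (a j)) = 0 := ha
  have hj : a j = 0 := by simpa [hij.symm] using congrFun ha' j
  simpa [hj] using ha'

/-- A coordinate `q^{f_i} ε_i` can be cleared using `q^{f_j} ε_j` when `ε_j ↦ q^{f_i - f_j} ε_i`
defines a homomorphism. -/
theorem exists_addAut_clear_coordinate {q k : ℕ} (hq : q.Prime) {e m : Fin k → ℕ}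
    {ε : (i : Fin k) → Fin (m i) → ZMod (q ^ e i)}
    (hε : ∀ i, ¬∃ y : Fin (m i) → ZMod (q ^ e i), q • y = ε i) (f : Fin k → ℕ) {i j : Fin k}
    (hij : i ≠ j) (hf : f j ≤ f i) (he : e i + f j ≤ e j + f i) :
    ∃ σ : AddAut ((i : Fin k) → Fin (m i) → ZMod (q ^ e i)),
      σ (fun s => q ^ f s • ε s) = fun s => q ^ Function.update f i (e i) s • ε s := by
  have : ∀ i, NeZero (q ^ e i) := fun i => ⟨pow_ne_zero _ hq.ne_zero⟩
  obtain ⟨ψ, hψ⟩ := exists_addMonoidHom_apply_eq hq (hε j) (-(q ^ (f i - f j) • ε i)) (by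
    rw [smul_neg, smul_smul, ← pow_add, pow_smul_eq_zero_of_le (by omega), neg_zero])
  obtain ⟨σ, hσ⟩ := exists_addAut_shear (B := fun i => Fin (m i) → ZMod (q ^ e i)) hij ψ
  refine ⟨σ, ?_⟩
  rw [hσ]
  funext s
  rcases eq_or_ne s i with rfl | hs
  · rw [Pi.add_apply, Pi.single_eq_same, map_nsmul, hψ, smul_neg, smul_smul, ← pow_add,
      Nat.add_sub_cancel' hf, add_neg_cancel, Function.update_self,
      pow_smul_eq_zero_of_le le_rfl]
  · rw [Pi.add_apply, Pi.single_eq_of_ne hs, add_zero, Function.update_of_ne hs]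

theorem galkinElem_map_filter_finRange {q k : ℕ} {e m : Fin k → ℕ}
    (ε : (i : Fin k) → Fin (m i) → ZMod (q ^ e i)) (f : Fin k → ℕ) :
    galkinElem q k e m ε
      (((List.finRange k).filter fun i => f i < e i).map fun i => (i, f i)) =
      fun i => q ^ f i • ε i := by
  rw [galkinElem, List.map_map, ← List.sum_toFinset _ ((List.nodup_finRange k).filter _)]
  funext s
  rw [Finset.sum_apply]
  simp only [Function.comp_apply]
  by_cases h : f s < e s
  · rw [Finset.sum_eq_single s]
    · simp
    · intro b _ hb
      exact Pi.single_eq_of_ne hb.symm _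
    · simp [h]
  · rw [pow_smul_eq_zero_of_le (not_lt.1 h)]
    refine Finset.sum_eq_zero fun b hb => Pi.single_eq_of_ne ?_ _
    rintro rfl
    simp [h] at hb

/-- Every element of `A = ⊕ᵢ (ℤ/q^{eᵢ}ℤ)^{nᵢ}` can be moved by an automorphism of `A`
to an element of the form `∑_s q^{f_s} ε_{i_s}` with `(i₁,f₁),…,(i_l,f_l) ∈ I(e₁,…,e_k)`. -/
theorem exists_aut_to_galkinElem (q : ℕ) (hq : q.Prime) (k : ℕ) (e m : Fin k → ℕ)
    (he1 : ∀ i, 1 ≤ e i) (hmono : StrictMono e) (hm : ∀ i, 0 < m i)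
    (ε : (i : Fin k) → Fin (m i) → ZMod (q ^ e i))
    (hε : ∀ i, ¬∃ y : Fin (m i) → ZMod (q ^ e i), q • y = ε i)
    (x : (i : Fin k) → Fin (m i) → ZMod (q ^ e i)) :
    ∃ (σ : AddAut ((i : Fin k) → Fin (m i) → ZMod (q ^ e i))) (l : List (Fin k × ℕ)),
      l ∈ GalkinI k e ∧ σ x = galkinElem q k e m ε l := by
  classical
  let P : ℕ → Prop := fun N => ∃ (σ : AddAut ((i : Fin k) → Fin (m i) → ZMod (q ^ e i)))
    (f : Fin k → ℕ), (σ x = fun i => q ^ f i • ε i) ∧ (∀ i, f i ≤ e i) ∧ ∑ i, (e i - f i) = N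
  have hP : ∃ N, P N := by
    choose f hf τ hτ using fun i => exists_addAut_apply_eq_pow_smul hq (hε i) (x i)
    exact ⟨_, AddEquiv.piCongrRight τ, f, funext hτ, hf, rfl⟩
  obtain ⟨σ, f, hσ, hf, hN⟩ := Nat.find_spec hP
  have key : ∀ i j, i ≠ j → f i < e i → f j ≤ f i → e j + f i < e i + f j := by
    intro i j hij hi hji
    by_contra! h
    obtain ⟨τ, hτ⟩ := exists_addAut_clear_coordinate hq hε f hij hji (by omega)
    refine Nat.find_min hP ?_ ⟨σ.trans τ, Function.update f i (e i),
      (congrArg τ hσ).trans hτ, ?_, rfl⟩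
    · rw [← hN]
      refine Finset.sum_lt_sum (fun s _ => ?_) ⟨i, Finset.mem_univ i, ?_⟩
      · rcases eq_or_ne s i with rfl | hs
        · simp
        · simp [hs]
      · simpa using hi
    · intro s
      rcases eq_or_ne s i with rfl | hs
      · simp
      · simpa [hs] using hf s
  refine ⟨σ, ((List.finRange k).filter fun i => f i < e i).map fun i => (i, f i), ⟨?_, ?_⟩,
    hσ.trans (galkinElem_map_filter_finRange ε f).symm⟩
  · intro p hp
    obtain ⟨i, hi, rfl⟩ := List.mem_map.1 hp
    simpa using hi
  · refine List.Pairwise.isChain (List.pairwise_map.2 ?_)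
    refine List.Pairwise.imp_of_mem ?_ ((List.pairwise_lt_finRange k).filter _)
    intro a b ha hb hab
    have ha' : f a < e a := by simpa using ha
    have hb' : f b < e b := by simpa using hb
    have hlt := hmono hab
    have h1 := key a b hab.ne ha'
    have h2 := key b a hab.ne' hb'
    dsimp only
    exact ⟨hab, by omega, by omega⟩
end

section
/- Let q be a prime, let 1 ≤ e_1 < ⋯ < e_k be integers and n_1,…,n_k > 0, and let A = A_1 ⊕ ⋯ ⊕ A_k where A_i = (ℤ/q^{e_i}ℤ)^{n_i}. For each i choose ε_i ∈ A_i \ qA_i. If (i_1,f_1),…,(i_l,f_l) and (j_1,g_1),…,(j_m,g_m) are two distinct sequences in I(e_1,…,e_k), then the elements Σ_{s=1}^{l} q^{f_s} ε_{i_s} and Σ_{s=1}^{m} q^{g_s} ε_{j_s} of A do not lie in the same orbit under the natural action of Aut(A) on A. -/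
/-- If `q ^ c • z = 0` in `(ℤ/q^eℤ)^ι` with `c < e`, then `z` is divisible by `q`. -/
theorem exists_smul_eq_of_pow_smul_eq_zero {ι : Type*} {q e c : ℕ} (hq : 0 < q) (hc : c < e)
    (z : ι → ZMod (q ^ e)) (hz : q ^ c • z = 0) : ∃ w : ι → ZMod (q ^ e), q • w = z := by
  have : NeZero (q ^ e) := ⟨(pow_pos hq e).ne'⟩
  have key : ∀ j, ∃ w : ZMod (q ^ e), q • w = z j := by
    intro j
    have h0 : ((q ^ c * (z j).val : ℕ) : ZMod (q ^ e)) = 0 := by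
      have h := congrFun hz j
      simp only [Pi.smul_apply, Pi.zero_apply, nsmul_eq_mul] at h
      simpa using h
    rw [ZMod.natCast_eq_zero_iff] at h0
    have hdvd : q ∣ (z j).val := by
      refine Nat.dvd_of_mul_dvd_mul_left (pow_pos hq c) ?_
      rw [← pow_succ]
      exact (pow_dvd_pow q hc).trans h0
    obtain ⟨t, ht⟩ := hdvd
    refine ⟨(t : ZMod (q ^ e)), ?_⟩
    rw [nsmul_eq_mul, ← Nat.cast_mul, ← ht, ZMod.natCast_zmod_val]
  choose w hw using key
  exact ⟨w, funext hw⟩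

/-- For `ε` not divisible by `q`, the element `q ^ c • ε` of `(ℤ/q^eℤ)^ι` is divisible by `q ^ b`
if and only if it vanishes or `b ≤ c`. -/
theorem exists_pow_smul_eq_pow_smul_iff {ι : Type*} {q e b c : ℕ} (hq : 0 < q)
    (ε : ι → ZMod (q ^ e)) (hε : ¬∃ y : ι → ZMod (q ^ e), q • y = ε) :
    (∃ y : ι → ZMod (q ^ e), q ^ b • y = q ^ c • ε) ↔ e ≤ c ∨ b ≤ c := by
  constructor
  · rintro ⟨y, hy⟩
    by_contra! h
    obtain ⟨d, rfl⟩ := Nat.exists_eq_add_of_lt h.2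
    have hz : q ^ c • (q ^ (d + 1) • y - ε) = 0 := by
      rw [smul_sub, ← mul_smul, ← pow_add, ← add_assoc, hy, sub_self]
    obtain ⟨w, hw⟩ := exists_smul_eq_of_pow_smul_eq_zero hq h.1 _ hz
    refine hε ⟨q ^ d • y - w, ?_⟩
    rw [smul_sub, hw, ← mul_smul, ← pow_succ', sub_sub_cancel]
  · rintro (h | h)
    · refine ⟨0, ?_⟩
      have h0 : ((q ^ c : ℕ) : ZMod (q ^ e)) = 0 :=
        (ZMod.natCast_eq_zero_iff _ _).2 (pow_dvd_pow q h)
      funext j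
      rw [smul_zero, Pi.smul_apply, nsmul_eq_mul, h0, zero_mul, Pi.zero_apply]
    · exact ⟨q ^ (c - b) • ε, by rw [← mul_smul, ← pow_add, Nat.add_sub_cancel' h]⟩

/-- In a sequence of `GalkinI k e` the defining inequalities hold between any two terms, not only
consecutive ones. -/
theorem GalkinI.pairwise {k : ℕ} {e : Fin k → ℕ} {l : List (Fin k × ℕ)} (h : l ∈ GalkinI k e) :
    l.Pairwise (fun a b => a.1 < b.1 ∧ a.2 < b.2 ∧ b.2 + e a.1 < a.2 + e b.1) := by
  have : IsTrans (Fin k × ℕ)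
      (fun a b => a.1 < b.1 ∧ a.2 < b.2 ∧ b.2 + e a.1 < a.2 + e b.1) :=
    ⟨fun a b c hab hbc => ⟨hab.1.trans hbc.1, hab.2.1.trans hbc.2.1, by omega⟩⟩
  exact List.isChain_iff_pairwise.1 h.2

theorem galkinElem_cons (q k : ℕ) (e m : Fin k → ℕ)
    (ε : (i : Fin k) → Fin (m i) → ZMod (q ^ e i)) (p : Fin k × ℕ) (l : List (Fin k × ℕ)) :
    galkinElem q k e m ε (p :: l) =
      Pi.single p.1 ((q ^ p.2) • ε p.1) + galkinElem q k e m ε l := by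
  simp [galkinElem]

theorem galkinElem_apply_of_notMem (q k : ℕ) (e m : Fin k → ℕ)
    (ε : (i : Fin k) → Fin (m i) → ZMod (q ^ e i)) (l : List (Fin k × ℕ)) (i : Fin k)
    (hi : ∀ p ∈ l, p.1 ≠ i) : galkinElem q k e m ε l i = 0 := by
  induction l with
  | nil => simp [galkinElem]
  | cons p l ih =>
    rw [List.forall_mem_cons] at hi
    rw [galkinElem_cons, Pi.add_apply, ih hi.2, Pi.single_eq_of_ne hi.1.symm, add_zero]

theorem galkinElem_apply_of_mem (q k : ℕ) (e m : Fin k → ℕ)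
    (ε : (i : Fin k) → Fin (m i) → ZMod (q ^ e i)) (l : List (Fin k × ℕ))
    (hl : l.Pairwise (fun a b => a.1 < b.1)) (p : Fin k × ℕ) (hp : p ∈ l) :
    galkinElem q k e m ε l p.1 = q ^ p.2 • ε p.1 := by
  induction l with
  | nil => simp at hp
  | cons r l ih =>
    rw [List.pairwise_cons] at hl
    rw [galkinElem_cons, Pi.add_apply]
    rcases List.mem_cons.1 hp with rfl | hp
    · rw [Pi.single_eq_same, galkinElem_apply_of_notMem _ _ _ _ _ _ _ fun r hr => (hl.1 r hr).ne',
        add_zero]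
    · rw [Pi.single_eq_of_ne (hl.1 p hp).ne', ih hl.2 hp, zero_add]

/-- The multiple `q ^ a • x` of the element `x` attached to a sequence is divisible by `q ^ b` if
and only if each of its nonzero terms visibly is. -/
theorem exists_pow_smul_eq_pow_smul_galkinElem_iff {q k : ℕ} (hq : 0 < q) {e m : Fin k → ℕ}
    (ε : (i : Fin k) → Fin (m i) → ZMod (q ^ e i))
    (hε : ∀ i, ¬∃ y : Fin (m i) → ZMod (q ^ e i), q • y = ε i)
    {l : List (Fin k × ℕ)} (hl : l ∈ GalkinI k e) (a b : ℕ) :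
    (∃ y : (i : Fin k) → Fin (m i) → ZMod (q ^ e i),
      q ^ b • y = q ^ a • galkinElem q k e m ε l) ↔
      ∀ p ∈ l, e p.1 ≤ a + p.2 ∨ b ≤ a + p.2 := by
  have hlt : l.Pairwise (fun a b => a.1 < b.1) := (GalkinI.pairwise hl).imp fun h => h.1
  constructor
  · rintro ⟨y, hy⟩ p hp
    refine (exists_pow_smul_eq_pow_smul_iff hq (ε p.1) (hε p.1)).1 ⟨y p.1, ?_⟩
    have h := congrFun hy p.1
    rwa [Pi.smul_apply, Pi.smul_apply, galkinElem_apply_of_mem _ _ _ _ _ _ hlt p hp, ← mul_smul,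
      ← pow_add] at h
  · intro h
    have key : ∀ i, ∃ y : Fin (m i) → ZMod (q ^ e i),
        q ^ b • y = q ^ a • galkinElem q k e m ε l i := by
      intro i
      by_cases hi : ∃ p ∈ l, p.1 = i
      · obtain ⟨p, hp, rfl⟩ := hi
        rw [galkinElem_apply_of_mem _ _ _ _ _ _ hlt p hp, ← mul_smul, ← pow_add]
        exact (exists_pow_smul_eq_pow_smul_iff hq (ε p.1) (hε p.1)).2 (h p hp)
      · push Not at hi
        exact ⟨0, by rw [galkinElem_apply_of_notMem _ _ _ _ _ _ _ hi, smul_zero, smul_zero]⟩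
    choose y hy using key
    exact ⟨y, funext hy⟩

/-- A sequence whose terms are dominated by those of a second one, which in turn are dominated by
those of the first, is contained in the second. -/
theorem GalkinI.subset_of_dominated {k : ℕ} {e : Fin k → ℕ} (he : Function.Injective e)
    {l₁ l₂ : List (Fin k × ℕ)} (h₁ : l₁ ∈ GalkinI k e)
    (h₁₂ : ∀ p ∈ l₁, ∃ r ∈ l₂, r.2 ≤ p.2 ∧ e p.1 + r.2 ≤ e r.1 + p.2)
    (h₂₁ : ∀ p ∈ l₂, ∃ r ∈ l₁, r.2 ≤ p.2 ∧ e p.1 + r.2 ≤ e r.1 + p.2) : l₁ ⊆ l₂ := by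
  intro p hp
  obtain ⟨r, hr, hrp, hrp'⟩ := h₁₂ p hp
  obtain ⟨s, hs, hsr, hsr'⟩ := h₂₁ r hr
  have hsp : s = p := by
    by_contra hne
    have : Std.Symm fun a b : Fin k × ℕ =>
        (a.2 < b.2 ∧ b.2 + e a.1 < a.2 + e b.1) ∨ (b.2 < a.2 ∧ a.2 + e b.1 < b.2 + e a.1) :=
      ⟨fun _ _ h => h.symm⟩
    have hsep := ((GalkinI.pairwise h₁).imp (S := fun a b : Fin k × ℕ =>
        (a.2 < b.2 ∧ b.2 + e a.1 < a.2 + e b.1) ∨ (b.2 < a.2 ∧ a.2 + e b.1 < b.2 + e a.1))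
      fun h => Or.inl h.2).forall
    have := hsep hs hp hne
    omega
  subst hsp
  have h2 : r.2 = s.2 := le_antisymm hrp hsr
  have h1 : r.1 = s.1 := he (by omega)
  rwa [← Prod.ext h1 h2]

/-- Two sequences of `GalkinI k e` with the same terms are equal. -/
theorem GalkinI.eq_of_subset {k : ℕ} {e : Fin k → ℕ} {l₁ l₂ : List (Fin k × ℕ)}
    (h₁ : l₁ ∈ GalkinI k e) (h₂ : l₂ ∈ GalkinI k e) (h₁₂ : l₁ ⊆ l₂) (h₂₁ : l₂ ⊆ l₁) :
    l₁ = l₂ := by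
  have p₁ := GalkinI.pairwise h₁
  have p₂ := GalkinI.pairwise h₂
  have hperm : l₁.Perm l₂ :=
    (List.perm_ext_iff_of_nodup (p₁.imp fun h heq => h.1.ne (congrArg Prod.fst heq))
      (p₂.imp fun h heq => h.1.ne (congrArg Prod.fst heq))).2 fun p => ⟨@h₁₂ p, @h₂₁ p⟩
  exact hperm.eq_of_pairwise (fun a b _ _ hab hba => (hab.1.asymm hba.1).elim) p₁ p₂

/-- Distinct sequences in `I(e₁,…,e_k)` give elements of `A = ⊕ᵢ (ℤ/q^{eᵢ}ℤ)^{nᵢ}`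
lying in distinct orbits of `Aut(A)`. -/
theorem galkinElem_not_in_same_orbit (q : ℕ) (hq : q.Prime) (k : ℕ) (e m : Fin k → ℕ)
    (he1 : ∀ i, 1 ≤ e i) (hmono : StrictMono e) (hm : ∀ i, 0 < m i)
    (ε : (i : Fin k) → Fin (m i) → ZMod (q ^ e i))
    (hε : ∀ i, ¬∃ y : Fin (m i) → ZMod (q ^ e i), q • y = ε i)
    (l₁ l₂ : List (Fin k × ℕ)) (h₁ : l₁ ∈ GalkinI k e) (h₂ : l₂ ∈ GalkinI k e)
    (hne : l₁ ≠ l₂) :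
    ∀ σ : AddAut ((i : Fin k) → Fin (m i) → ZMod (q ^ e i)),
      σ (galkinElem q k e m ε l₁) ≠ galkinElem q k e m ε l₂ := by
  intro σ hσ
  have dom : ∀ {l l' : List (Fin k × ℕ)}, l ∈ GalkinI k e → l' ∈ GalkinI k e →
      ∀ τ : AddAut ((i : Fin k) → Fin (m i) → ZMod (q ^ e i)),
      τ (galkinElem q k e m ε l') = galkinElem q k e m ε l →
      ∀ p ∈ l, ∃ r ∈ l', r.2 ≤ p.2 ∧ e p.1 + r.2 ≤ e r.1 + p.2 := by
    intro l l' hl hl' τ hτ p hp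
    by_contra! hcon
    have hp2 := hl.1 p hp
    obtain ⟨y, hy⟩ := (exists_pow_smul_eq_pow_smul_galkinElem_iff hq.pos ε hε hl'
      (e p.1 - p.2 - 1) (e p.1)).2 fun r hr => by
        have := hcon r hr
        omega
    have := (exists_pow_smul_eq_pow_smul_galkinElem_iff hq.pos ε hε hl
      (e p.1 - p.2 - 1) (e p.1)).1 ⟨τ y, by rw [← hτ, ← map_nsmul, hy, map_nsmul]⟩ p hp
    omega
  have h₂₁ := dom h₂ h₁ σ hσ
  have h₁₂ := dom h₁ h₂ σ.symm (by rw [← hσ]; exact σ.symm_apply_apply _)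
  exact hne (GalkinI.eq_of_subset h₁ h₂
    (GalkinI.subset_of_dominated hmono.injective h₁ h₁₂ h₂₁)
    (GalkinI.subset_of_dominated hmono.injective h₂ h₂₁ h₁₂))
end

section
/- For every prime q and natural number n, the number N(n) of isomorphism classes of pointed abelian groups (A,c) with |A| = q^n equals the sum of |I(e_1,…,e_k)| over all tuples (e_1,…,e_k; n_1,…,n_k) with 1 ≤ e_1 < ⋯ < e_k, n_1,…,n_k > 0, and n_1 e_1 + ⋯ + n_k e_k = n. -/
namespace PtdAbGroup

/-- The element of `∏ p, ℤ/q^(e p)` whose `p`-th coordinate is `q ^ f` if `S p = some f`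
and `0` if `S p = none`. -/
def elem (q : ℕ) {ι : Type} (e : ι → ℕ) (S : ι → Option ℕ) : ∀ p, ZMod (q ^ e p) :=
  fun p => (S p).elim 0 (fun f => (q : ZMod (q ^ e p)) ^ f)

section Reduction

variable {q : ℕ}

lemma exists_addEquiv_eq_pow [hq : Fact q.Prime] (e : ℕ) (z : ZMod (q ^ e)) :
    ∃ (u : ZMod (q ^ e) ≃+ ZMod (q ^ e)) (s : Option ℕ),
      u z = s.elim 0 (fun f => (q : ZMod (q ^ e)) ^ f) ∧ ∀ f, s = some f → f < e := by
  by_cases hz : z = 0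
  · exact ⟨AddEquiv.refl _, none, by simpa using hz, by simp⟩
  · have hv : z.val ≠ 0 := by simpa [ZMod.val_eq_zero] using hz
    obtain ⟨f, u, hu, hvu⟩ := Nat.exists_eq_pow_mul_and_not_dvd hv q hq.out.ne_one
    have hcop : u.Coprime (q ^ e) :=
      Nat.Coprime.pow_right _ ((Nat.Prime.coprime_iff_not_dvd hq.out).2 hu).symm
    have hz' : z = (q : ZMod (q ^ e)) ^ f * (ZMod.unitOfCoprime u hcop : (ZMod (q ^ e))ˣ) := by
      rw [ZMod.coe_unitOfCoprime, ← ZMod.natCast_zmod_val z, hvu]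
      push_cast
      rfl
    refine ⟨AddAut.mulLeft (ZMod.unitOfCoprime u hcop)⁻¹, some f, ?_, ?_⟩
    · rw [AddAut.mulLeft_apply_apply]
      conv_lhs => rw [hz']
      rw [Units.smul_def, smul_eq_mul, mul_comm, mul_assoc, Units.mul_inv, mul_one]
      rfl
    · rintro f' ⟨⟩
      have h1 : q ^ f ≤ z.val :=
        Nat.le_of_dvd (Nat.pos_of_ne_zero hv) (hvu ▸ Dvd.intro _ rfl)
      exact (Nat.pow_lt_pow_iff_right hq.out.one_lt).1 (h1.trans_lt (ZMod.val_lt z))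

lemma exists_addEquiv_eq_elem [Fact q.Prime] {ι : Type} (e : ι → ℕ) (x : ∀ p, ZMod (q ^ e p)) :
    ∃ (Φ : (∀ p, ZMod (q ^ e p)) ≃+ ∀ p, ZMod (q ^ e p)) (S : ι → Option ℕ),
      Φ x = elem q e S ∧ ∀ p f, S p = some f → f < e p := by
  choose u s hu hs using fun p => exists_addEquiv_eq_pow (e p) (x p)
  exact ⟨AddEquiv.piCongrRight u, s, funext hu, hs⟩

lemma exists_addMonoidHom_pow_eq_pow {a b f g : ℕ} (h : f + (b - a) ≤ g) :
    ∃ φ : ZMod (q ^ a) →+ ZMod (q ^ b), φ ((q : ZMod (q ^ a)) ^ f) = (q : ZMod (q ^ b)) ^ g := by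
  have h0 : zmultiplesHom (ZMod (q ^ b)) ((q : ZMod (q ^ b)) ^ (g - f)) ((q ^ a : ℕ) : ℤ) = 0 := by
    rw [zmultiplesHom_apply, natCast_zsmul, nsmul_eq_mul]
    have : b ≤ a + (g - f) := by omega
    rw [Nat.cast_pow, ← pow_add, ← Nat.cast_pow, ZMod.natCast_eq_zero_iff]
    exact pow_dvd_pow _ this
  refine ⟨ZMod.lift (q ^ a) ⟨_, h0⟩, ?_⟩
  have h1 : (q : ZMod (q ^ a)) ^ f = (((q ^ f : ℕ) : ℤ) : ZMod (q ^ a)) := by push_cast; rfl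
  rw [h1, ZMod.lift_coe]
  simp only [zmultiplesHom_apply, natCast_zsmul, nsmul_eq_mul]
  rw [Nat.cast_pow, ← pow_add]
  congr 1
  omega

/-- The automorphism of a product of groups that subtracts from the `j`-th coordinate the image of
the `i`-th one under `φ`. -/
def transvection {ι : Type} [DecidableEq ι] {G : ι → Type} [∀ p, AddCommGroup (G p)] {i j : ι}
    (hij : i ≠ j) (φ : G i →+ G j) : (∀ p, G p) ≃+ ∀ p, G p where
  toFun x := x - Pi.single j (φ (x i))
  invFun x := x + Pi.single j (φ (x i))
  left_inv x := by simp [hij]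
  right_inv x := by simp [hij]
  map_add' x y := by
    simp only [Pi.add_apply, map_add, Pi.single_add]
    abel

lemma exists_addEquiv_elem_eq_elem_antichain {ι : Type} [Fintype ι] (e : ι → ℕ)
    (S : ι → Option ℕ) (hS : ∀ p f, S p = some f → f < e p) :
    ∃ (Φ : (∀ p, ZMod (q ^ e p)) ≃+ ∀ p, ZMod (q ^ e p)) (T : ι → Option ℕ),
      Φ (elem q e S) = elem q e T ∧ (∀ p f, T p = some f → f < e p) ∧
      ∀ i j f g, i ≠ j → T i = some f → T j = some g → g < f + (e j - e i) := by
  classical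
  induction hn : (Finset.univ.filter fun p => S p ≠ none).card using Nat.strong_induction_on
    generalizing S with
  | _ n ih =>
    by_cases hanti : ∀ i j f g, i ≠ j → S i = some f → S j = some g → g < f + (e j - e i)
    · exact ⟨AddEquiv.refl _, S, rfl, hS, hanti⟩
    · push Not at hanti
      obtain ⟨i, j, f, g, hij, hi, hj, hle⟩ := hanti
      obtain ⟨φ, hφ⟩ := exists_addMonoidHom_pow_eq_pow (q := q) hle
      have hstep : transvection hij φ (elem q e S) = elem q e (Function.update S j none) := by
        funext p
        change elem q e S p - (Pi.single j (φ (elem q e S i)) : ∀ p, ZMod (q ^ e p)) p = _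
        have hei : elem q e S i = (q : ZMod (q ^ e i)) ^ f := by simp [elem, hi]
        rw [hei, hφ]
        by_cases hp : p = j
        · subst hp
          simp [elem, hj]
        · simp [elem, hp]
      have hlt : (Finset.univ.filter fun p => Function.update S j none p ≠ none).card < n := by
        rw [← hn]
        refine Finset.card_lt_card ⟨fun p => ?_, fun h => ?_⟩
        · by_cases hp : p = j
          · subst hp; simp
          · simp [hp]
        · have := h (by simp [hj] : j ∈ _)
          simp at this
      obtain ⟨Φ, T, h1, h2, h3⟩ := ih _ hlt (Function.update S j none) (by
        intro p f hp
        by_cases hpj : p = j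
        · subst hpj; simp at hp
        · exact hS p f (by simpa [hpj] using hp)) rfl
      exact ⟨(transvection hij φ).trans Φ, T, by rw [AddEquiv.trans_apply, hstep, h1], h2, h3⟩

lemma exists_addEquiv_elem_reindex {ι κ : Type} (σ : ι ≃ κ) (e : ι → ℕ) (e' : κ → ℕ)
    (he : ∀ p, e p = e' (σ p)) (S : κ → Option ℕ) :
    ∃ Φ : (∀ p, ZMod (q ^ e p)) ≃+ ∀ s, ZMod (q ^ e' s),
      Φ (elem q e (S ∘ σ)) = elem q e' S := by
  obtain rfl : e = e' ∘ σ := funext he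
  refine ⟨(RingEquiv.piCongrLeft (fun s => ZMod (q ^ e' s)) σ).toAddEquiv, ?_⟩
  change Equiv.piCongrLeft (fun s => ZMod (q ^ e' s)) σ _ = _
  rw [← Equiv.eq_symm_apply]
  rfl

end Reduction

section Invariants

variable {q : ℕ} [hq : Fact q.Prime]

lemma exists_nsmul_eq_nsmul_pow_iff (e j f g : ℕ) :
    (∃ y : ZMod (q ^ e), q ^ (j + f) • y = q ^ j • (q : ZMod (q ^ e)) ^ g) ↔
      e ≤ g + j ∨ f ≤ g := by
  constructor
  · rintro ⟨y, hy⟩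
    by_contra! h
    obtain ⟨y, rfl⟩ := ZMod.natCast_zmod_surjective y
    have h1 : ((q ^ (j + f) * y : ℕ) : ZMod (q ^ e)) = ((q ^ (j + g) : ℕ) : ZMod (q ^ e)) := by
      simp only [nsmul_eq_mul] at hy
      push_cast at hy ⊢
      rw [hy, pow_add]
    rw [ZMod.natCast_eq_natCast_iff] at h1
    have h2 := h1.of_dvd (pow_dvd_pow q (by omega : j + g + 1 ≤ e))
    have h3 : q ^ (j + g + 1) ∣ q ^ (j + g) := by
      rw [← Nat.modEq_zero_iff_dvd]
      refine h2.symm.trans ((Nat.modEq_zero_iff_dvd).2 ?_)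
      exact (pow_dvd_pow q (by omega)).trans (Dvd.intro _ rfl)
    have := (Nat.pow_dvd_pow_iff_le_right hq.out.one_lt).1 h3
    omega
  · rintro (h | h)
    · refine ⟨0, ?_⟩
      rw [smul_zero, nsmul_eq_mul, Nat.cast_pow, ← pow_add, ← Nat.cast_pow, eq_comm,
        ZMod.natCast_eq_zero_iff]
      exact pow_dvd_pow _ (by omega)
    · refine ⟨(q : ZMod (q ^ e)) ^ (g - f), ?_⟩
      simp only [nsmul_eq_mul, Nat.cast_pow, ← pow_add]
      congr 1
      omega

lemma exists_nsmul_eq_nsmul_elem_iff {ι : Type} (e : ι → ℕ) (S : ι → Option ℕ) (j f : ℕ) :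
    (∃ y : ∀ p, ZMod (q ^ e p), q ^ (j + f) • y = q ^ j • elem q e S) ↔
      ∀ p g, S p = some g → e p ≤ g + j ∨ f ≤ g := by
  have key : ∀ p, (∃ y : ZMod (q ^ e p), q ^ (j + f) • y = q ^ j • elem q e S p) ↔
      ∀ g, S p = some g → e p ≤ g + j ∨ f ≤ g := by
    intro p
    cases hp : S p with
    | none => simpa [elem, hp] using ⟨0, by simp⟩
    | some g => simpa [elem, hp] using exists_nsmul_eq_nsmul_pow_iff (q := q) (e p) j f g
  constructor
  · rintro ⟨y, hy⟩ p
    exact (key p).1 ⟨y p, congrFun hy p⟩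
  · intro h
    choose y hy using fun p => (key p).2 (h p)
    exact ⟨y, funext hy⟩

lemma card_pi_zmod {ι : Type} [Fintype ι] (e : ι → ℕ) :
    Nat.card (∀ p, ZMod (q ^ e p)) = q ^ ∑ p, e p := by
  simp [Nat.card_pi, Finset.prod_pow_eq_pow_sum]

lemma card_nsmul_eq_zero_pi_zmod {ι : Type} [Fintype ι] (e : ι → ℕ) (j : ℕ) :
    Nat.card {x : ∀ p, ZMod (q ^ e p) // q ^ j • x = 0} = q ^ ∑ p, min (e p) j := by
  have h1 : Nat.card {x : ∀ p, ZMod (q ^ e p) // q ^ j • x = 0} =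
      Nat.card (∀ p, {x : ZMod (q ^ e p) // q ^ j • x = 0}) := by
    refine Nat.card_congr ((Equiv.subtypeEquivRight fun x => ?_).trans Equiv.subtypePiEquivPi)
    exact funext_iff
  rw [h1, Nat.card_pi, ← Finset.prod_pow_eq_pow_sum]
  refine Finset.prod_congr rfl fun p _ => ?_
  have h2 := IsAddCyclic.card_nsmulAddMonoidHom_ker (ZMod (q ^ e p)) (q ^ j)
  rw [Nat.card_zmod] at h2
  have h3 : (q ^ e p).gcd (q ^ j) = q ^ min (e p) j := by
    rcases le_total (e p) j with h | h
    · rw [min_eq_left h, Nat.gcd_eq_left (pow_dvd_pow q h)]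
    · rw [min_eq_right h, Nat.gcd_eq_right (pow_dvd_pow q h)]
  rw [← h3]
  exact h2

end Invariants

section GalkinI

variable {k : ℕ} {e : Fin k → ℕ}

lemma mem_galkinI_iff_pairwise {l : List (Fin k × ℕ)} :
    l ∈ GalkinI k e ↔ (∀ p ∈ l, p.2 < e p.1) ∧
      l.Pairwise (fun a b => a.1 < b.1 ∧ a.2 < b.2 ∧ b.2 + e a.1 < a.2 + e b.1) := by
  let R : Fin k × ℕ → Fin k × ℕ → Prop :=
    fun a b => a.1 < b.1 ∧ a.2 < b.2 ∧ b.2 + e a.1 < a.2 + e b.1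
  have : Trans R R R := ⟨fun {a b c} hab hbc =>
    ⟨hab.1.trans hbc.1, hab.2.1.trans hbc.2.1, by have := hab.2.2; have := hbc.2.2; omega⟩⟩
  exact and_congr_right fun _ => List.isChain_iff_pairwise (R := R)

lemma eq_or_lt_of_mem_galkinI {l : List (Fin k × ℕ)} (hl : l ∈ GalkinI k e)
    {a b : Fin k × ℕ} (ha : a ∈ l) (hb : b ∈ l) :
    a = b ∨ (a.1 < b.1 ∧ a.2 < b.2 ∧ b.2 + e a.1 < a.2 + e b.1) ∨
      (b.1 < a.1 ∧ b.2 < a.2 ∧ a.2 + e b.1 < b.2 + e a.1) := by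
  have hp := (mem_galkinI_iff_pairwise.1 hl).2
  let R : Fin k × ℕ → Fin k × ℕ → Prop := fun a b =>
    a = b ∨ (a.1 < b.1 ∧ a.2 < b.2 ∧ b.2 + e a.1 < a.2 + e b.1) ∨
      (b.1 < a.1 ∧ b.2 < a.2 ∧ a.2 + e b.1 < b.2 + e a.1)
  have : Std.Symm R := ⟨fun a b h => h.elim (fun h => Or.inl h.symm) fun h => Or.inr h.symm⟩
  exact List.Pairwise.forall_of_forall (R := R) (fun _ _ => Or.inl rfl)
    (hp.imp fun h => Or.inr (Or.inl h)) ha hb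

lemma snd_eq_of_mem_galkinI {l : List (Fin k × ℕ)} (hl : l ∈ GalkinI k e) {i : Fin k} {f g : ℕ}
    (hf : (i, f) ∈ l) (hg : (i, g) ∈ l) : f = g := by
  rcases eq_or_lt_of_mem_galkinI hl hf hg with h | h | h
  · exact congrArg Prod.snd h
  · exact absurd h.1 (lt_irrefl _)
  · exact absurd h.1 (lt_irrefl _)

open Classical in
/-- The partial function `Fin k → ℕ` whose graph is the underlying set of a list. -/
noncomputable def listOpt (l : List (Fin k × ℕ)) (i : Fin k) : Option ℕ :=
  if h : ∃ f, (i, f) ∈ l then some h.choose else none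

lemma listOpt_eq_some_iff {l : List (Fin k × ℕ)} (hl : l ∈ GalkinI k e) {i : Fin k} {f : ℕ} :
    listOpt l i = some f ↔ (i, f) ∈ l := by
  unfold listOpt
  split_ifs with h
  · refine ⟨fun hf => ?_, fun hf => ?_⟩
    · rw [← Option.some.inj hf]
      exact h.choose_spec
    · rw [snd_eq_of_mem_galkinI hl h.choose_spec hf]
  · exact ⟨fun hf => absurd hf (by simp), fun hf => absurd ⟨f, hf⟩ h⟩

lemma eq_of_mem_iff {l l' : List (Fin k × ℕ)} (hl : l ∈ GalkinI k e) (hl' : l' ∈ GalkinI k e)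
    (h : ∀ a, a ∈ l ↔ a ∈ l') : l = l' := by
  have hp := (mem_galkinI_iff_pairwise.1 hl).2.imp (S := fun a b => a.1 < b.1) fun h => h.1
  have hp' := (mem_galkinI_iff_pairwise.1 hl').2.imp (S := fun a b => a.1 < b.1) fun h => h.1
  have hn : l.Nodup := hp.imp fun h h' => (h' ▸ h).false
  have hn' : l'.Nodup := hp'.imp fun h h' => (h' ▸ h).false
  exact List.Perm.eq_of_pairwise (fun a b _ _ h1 h2 => absurd h1 h2.asymm) hp hp'
    ((List.perm_ext_iff_of_nodup hn hn').2 h)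

lemma mem_of_forall_iff (he : StrictMono e) {l l' : List (Fin k × ℕ)} (hl : l ∈ GalkinI k e)
    (h : ∀ j f, (∀ p g, (p, g) ∈ l → e p ≤ g + j ∨ f ≤ g) ↔
      ∀ p g, (p, g) ∈ l' → e p ≤ g + j ∨ f ≤ g) {a : Fin k × ℕ} (ha : a ∈ l) : a ∈ l' := by
  have key : ∀ j f, (∃ p g, (p, g) ∈ l ∧ g + j < e p ∧ g < f) ↔
      ∃ p g, (p, g) ∈ l' ∧ g + j < e p ∧ g < f := by
    intro j f
    have := not_congr (h j f)
    push Not at this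
    exact this
  obtain ⟨i, g⟩ := a
  have hg := hl.1 _ ha
  dsimp only at hg
  obtain ⟨i', g', hm', h1, h2⟩ := (key (e i - g - 1) (g + 1)).1 ⟨i, g, ha, by omega, by omega⟩
  obtain ⟨i'', g'', hm'', h3, h4⟩ :=
    (key (e i' - g' - 1) (g' + 1)).2 ⟨i', g', hm', by omega, by omega⟩
  have hc := eq_or_lt_of_mem_galkinI hl ha hm''
  simp only [Prod.mk.injEq] at hc
  have h5 : i = i'' ∧ g = g'' := by
    rcases hc with hc | hc | hc
    · exact hc
    · omega
    · omega
  obtain ⟨rfl, rfl⟩ := h5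
  have h6 : g' = g := by omega
  have h7 : e i' = e i := by omega
  rw [← he.injective h7, ← h6]
  exact hm'

lemma exists_mem_galkinI (he : StrictMono e) (S : Fin k → Option ℕ)
    (hS : ∀ i f, S i = some f → f < e i)
    (hanti : ∀ i j f g, i ≠ j → S i = some f → S j = some g → g < f + (e j - e i)) :
    ∃ l ∈ GalkinI k e, listOpt l = S := by
  let l : List (Fin k × ℕ) := (List.finRange k).filterMap fun i => (S i).map fun f => (i, f)
  have hmem : ∀ i f, (i, f) ∈ l ↔ S i = some f := by
    intro i f
    simp [l, List.mem_filterMap]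
  have hl : l ∈ GalkinI k e := by
    refine mem_galkinI_iff_pairwise.2 ⟨fun p hp => hS _ _ ((hmem p.1 p.2).1 hp), ?_⟩
    refine List.pairwise_filterMap.2 ((List.pairwise_lt_finRange k).imp ?_)
    intro i j hij a ha b hb
    obtain ⟨f, hf, rfl⟩ := Option.map_eq_some_iff.1 ha
    obtain ⟨g, hg, rfl⟩ := Option.map_eq_some_iff.1 hb
    have h1 := hanti i j f g hij.ne hf hg
    have h2 := hanti j i g f hij.ne' hg hf
    have h3 := he hij
    exact ⟨hij, by dsimp only; omega, by dsimp only; omega⟩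
  refine ⟨l, hl, funext fun i => Option.ext fun f => ?_⟩
  rw [listOpt_eq_some_iff hl, hmem]

end GalkinI

lemma eq_of_sum_mul_min_eq {k k' : ℕ} {e m : Fin k → ℕ} {e' m' : Fin k' → ℕ}
    (he : StrictMono e) (he' : StrictMono e') (he1 : ∀ i, 1 ≤ e i) (he1' : ∀ i, 1 ≤ e' i)
    (hm : ∀ i, 0 < m i) (hm' : ∀ i, 0 < m' i)
    (h : ∀ j, ∑ i, m i * min (e i) j = ∑ i, m' i * min (e' i) j) :
    ∃ hk : k = k', e = e' ∘ Fin.cast hk ∧ m = m' ∘ Fin.cast hk := by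
  have second_diff : ∀ {k : ℕ} (e m : Fin k → ℕ) (d : ℕ),
      (∑ i, if e i = d + 1 then m i else 0) + ∑ i, m i * min (e i) (d + 2) +
        ∑ i, m i * min (e i) d = 2 * ∑ i, m i * min (e i) (d + 1) := by
    intro k e m d
    rw [Finset.mul_sum, ← Finset.sum_add_distrib, ← Finset.sum_add_distrib]
    refine Finset.sum_congr rfl fun i _ => ?_
    have : (if e i = d + 1 then 1 else 0) + min (e i) (d + 2) + min (e i) d =
        2 * min (e i) (d + 1) := by
      split_ifs <;> omega
    calc _ = m i * ((if e i = d + 1 then 1 else 0) + min (e i) (d + 2) + min (e i) d) := by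
          split_ifs <;> ring
      _ = _ := by rw [this]; ring
  have hN : ∀ d, 1 ≤ d → (∑ i, if e i = d then m i else 0) = ∑ i, if e' i = d then m' i else 0 := by
    rintro (_ | d) hd
    · omega
    · have h1 := second_diff e m d
      have h2 := second_diff e' m' d
      rw [h, h, h] at h1
      omega
  have count_apply : ∀ {k : ℕ} (e m : Fin k → ℕ), StrictMono e → ∀ i,
      (∑ j, if e j = e i then m j else 0) = m i := by
    intro k e m he i
    simp [he.injective.eq_iff]
  have mem_range : ∀ {k k' : ℕ} (e m : Fin k → ℕ) (e' m' : Fin k' → ℕ), StrictMono e →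
      (∀ i, 0 < m i) → (∀ i, 1 ≤ e i) → (∀ d, 1 ≤ d → (∑ i, if e i = d then m i else 0) =
        ∑ i, if e' i = d then m' i else 0) → Set.range e ⊆ Set.range e' := by
    rintro k k' e m e' m' he hm he1 hN _ ⟨i, rfl⟩
    by_contra hcon
    have h1 := hN (e i) (he1 i)
    rw [count_apply e m he, Finset.sum_eq_zero] at h1
    · exact (hm i).ne' h1
    · intro j _
      exact if_neg fun hj => hcon ⟨j, hj⟩
  have hr : Set.range e = Set.range e' :=
    (mem_range e m e' m' he hm he1 hN).antisymm
      (mem_range e' m' e m he' hm' he1' fun d hd => (hN d hd).symm)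
  have hk : k = k' := by
    have h1 := Set.ncard_range_of_injective he.injective
    have h2 := Set.ncard_range_of_injective he'.injective
    rw [hr] at h1
    simpa using h1.symm.trans h2
  subst hk
  obtain rfl := (he.range_inj he').1 hr
  refine ⟨rfl, rfl, funext fun i => ?_⟩
  have h1 := hN (e i) (he1 i)
  rwa [count_apply e m he, count_apply e m' he] at h1

section Model

/-- The partial function on `Σ i, Fin (m i)` that is `S` on the first copy of each index and
undefined on all others. -/
def sigmaSupport {k : ℕ} (m : Fin k → ℕ) (S : Fin k → Option ℕ) (s : Σ i, Fin (m i)) : Option ℕ :=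
  if s.2.val = 0 then S s.1 else none

/-- The pointed abelian group `(⨁ᵢ (ℤ/q^(e i))^(m i), ∑ q^f xᵢ)` attached to a list of pairs
`(i, f)`, where `xᵢ` generates the first copy of `ℤ/q^(e i)`. -/
noncomputable def model (q : ℕ) {k : ℕ} (e m : Fin k → ℕ) (l : List (Fin k × ℕ)) : PtdAbGroup where
  carrier := ∀ s : Σ i, Fin (m i), ZMod (q ^ e s.1)
  pt := elem q (fun s : Σ i, Fin (m i) => e s.1) (sigmaSupport m (listOpt l))

lemma sum_sigma_fin {k : ℕ} (m g : Fin k → ℕ) :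
    ∑ s : Σ i, Fin (m i), g s.1 = ∑ i, m i * g i := by
  simp [Fintype.sum_sigma]

variable {q : ℕ} [hq : Fact q.Prime]

lemma card_model {k : ℕ} (e m : Fin k → ℕ) (l : List (Fin k × ℕ)) :
    Nat.card (model q e m l).carrier = q ^ ∑ i, m i * e i := by
  rw [← sum_sigma_fin m e]
  exact card_pi_zmod _

lemma Iso.card_nsmul_eq_zero {P Q : PtdAbGroup} (h : P.Iso Q) (r : ℕ) :
    Nat.card {x : P.carrier // r • x = 0} = Nat.card {x : Q.carrier // r • x = 0} := by
  obtain ⟨f, -⟩ := h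
  refine Nat.card_congr (f.toEquiv.subtypeEquiv fun x => ?_)
  change _ ↔ r • f x = 0
  rw [← map_nsmul, map_eq_zero_iff f f.injective]

lemma Iso.exists_nsmul_eq_iff {P Q : PtdAbGroup} (h : P.Iso Q) (r s : ℕ) :
    (∃ y : P.carrier, r • y = s • P.pt) ↔ ∃ y : Q.carrier, r • y = s • Q.pt := by
  obtain ⟨f, hf⟩ := h
  rw [f.surjective.exists]
  refine exists_congr fun y => ?_
  rw [← hf, ← map_nsmul, ← map_nsmul, f.injective.eq_iff]

lemma iso_equivalence_s8 : Equivalence Iso where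
  refl P := ⟨AddEquiv.refl _, rfl⟩
  symm := fun ⟨f, hf⟩ => ⟨f.symm, by rw [← hf, f.symm_apply_apply]⟩
  trans := fun ⟨f, hf⟩ ⟨g, hg⟩ => ⟨f.trans g, by rw [AddEquiv.trans_apply, hf, hg]⟩

lemma exists_nsmul_eq_nsmul_model_pt_iff {k : ℕ} {e m : Fin k → ℕ} (hm : ∀ i, 0 < m i)
    {l : List (Fin k × ℕ)} (hl : l ∈ GalkinI k e) (j f : ℕ) :
    (∃ y : (model q e m l).carrier, q ^ (j + f) • y = q ^ j • (model q e m l).pt) ↔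
      ∀ p g, (p, g) ∈ l → e p ≤ g + j ∨ f ≤ g := by
  refine (exists_nsmul_eq_nsmul_elem_iff (q := q) _ _ j f).trans ⟨fun h p g hp => ?_, ?_⟩
  · exact h ⟨p, ⟨0, hm p⟩⟩ g (by simpa [sigmaSupport] using (listOpt_eq_some_iff hl).2 hp)
  · rintro h ⟨p, t⟩ g hp
    unfold sigmaSupport at hp
    split_ifs at hp
    exact h p g ((listOpt_eq_some_iff hl).1 hp)

lemma eq_of_model_iso {k k' : ℕ} {e m : Fin k → ℕ} {e' m' : Fin k' → ℕ}
    {l : List (Fin k × ℕ)} {l' : List (Fin k' × ℕ)}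
    (he : StrictMono e) (he' : StrictMono e') (he1 : ∀ i, 1 ≤ e i) (he1' : ∀ i, 1 ≤ e' i)
    (hm : ∀ i, 0 < m i) (hm' : ∀ i, 0 < m' i)
    (h : (model q e m l).Iso (model q e' m' l')) :
    ∃ hk : k = k', e = e' ∘ Fin.cast hk ∧ m = m' ∘ Fin.cast hk := by
  refine eq_of_sum_mul_min_eq he he' he1 he1' hm hm' fun j => ?_
  rw [← sum_sigma_fin m fun i => min (e i) j, ← sum_sigma_fin m' fun i => min (e' i) j]
  apply Nat.pow_right_injective hq.out.two_le
  have h1 := h.card_nsmul_eq_zero (q ^ j)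
  exact (card_nsmul_eq_zero_pi_zmod (q := q) _ j).symm.trans
    (h1.trans (card_nsmul_eq_zero_pi_zmod (q := q) _ j))

lemma list_eq_of_model_iso {k : ℕ} {e m : Fin k → ℕ} {l l' : List (Fin k × ℕ)}
    (he : StrictMono e) (hm : ∀ i, 0 < m i) (hl : l ∈ GalkinI k e) (hl' : l' ∈ GalkinI k e)
    (h : (model q e m l).Iso (model q e m l')) : l = l' := by
  have key : ∀ j f, (∀ p g, (p, g) ∈ l → e p ≤ g + j ∨ f ≤ g) ↔
      ∀ p g, (p, g) ∈ l' → e p ≤ g + j ∨ f ≤ g := fun j f => by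
    rw [← exists_nsmul_eq_nsmul_model_pt_iff (q := q) hm hl,
      ← exists_nsmul_eq_nsmul_model_pt_iff (q := q) hm hl']
    exact h.exists_nsmul_eq_iff _ _
  exact eq_of_mem_iff hl hl' fun a => ⟨mem_of_forall_iff he hl key,
    mem_of_forall_iff he hl' fun j f => (key j f).symm⟩

/-- A function on a finite type factors through the increasing enumeration of its range, and the
fibres can be enumerated so that a prescribed set meeting each fibre at most once consists of
initial elements. -/
lemma exists_equiv_sigma_fin {ι : Type} [Fintype ι] (e : ι → ℕ) (s : Set ι) (hs : s.InjOn e) :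
    ∃ (k : ℕ) (e' m : Fin k → ℕ) (σ : ι ≃ Σ i, Fin (m i)), StrictMono e' ∧ (∀ i, 0 < m i) ∧
      (∀ p, e p = e' (σ p).1) ∧ ∀ p ∈ s, (σ p).2.val = 0 := by
  classical
  let r := Finset.univ.image e
  let o := r.orderIsoOfFin rfl
  let g : ι → Fin r.card := fun p => o.symm ⟨e p, Finset.mem_image_of_mem e (Finset.mem_univ p)⟩
  have hg : ∀ p, e p = o (g p) := fun p => by simp [g]
  have hpos : ∀ i, 0 < Fintype.card {p // g p = i} := by
    intro i
    obtain ⟨p, -, hp⟩ := Finset.mem_image.1 (o i).2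
    refine Fintype.card_pos_iff.2 ⟨⟨p, ?_⟩⟩
    simp [g, hp]
  have hτ : ∀ i, ∃ τ : {p // g p = i} ≃ Fin (Fintype.card {p // g p = i}),
      ∀ p, p.1 ∈ s → (τ p).val = 0 := by
    intro i
    let τ := Fintype.equivFin {p // g p = i}
    by_cases h : ∃ p : {p // g p = i}, p.1 ∈ s
    · obtain ⟨p, hp⟩ := h
      refine ⟨τ.trans (Equiv.swap (τ p) ⟨0, hpos i⟩), fun p' hp' => ?_⟩
      have : p' = p := Subtype.ext (hs hp' hp (by rw [hg, hg, p.2, p'.2]))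
      simp [this]
    · exact ⟨τ, fun p hp => absurd ⟨p, hp⟩ h⟩
  choose τ hτ using hτ
  refine ⟨r.card, fun i => o i, _, (Equiv.sigmaFiberEquiv g).symm.trans (Equiv.sigmaCongrRight τ),
    fun i j hij => o.strictMono hij, hpos, hg, fun p hp => hτ _ _ hp⟩

lemma exists_addEquiv_pi_zmod (A : Type) [AddCommGroup A] {n : ℕ} (hA : Nat.card A = q ^ n) :
    ∃ (ι : Type) (_ : Fintype ι) (e : ι → ℕ), (∀ i, 1 ≤ e i) ∧
      Nonempty (A ≃+ ∀ i, ZMod (q ^ e i)) := by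
  have : Finite A := Nat.finite_of_card_ne_zero (by rw [hA]; exact pow_ne_zero _ hq.out.ne_zero)
  obtain ⟨ι, _, d, hd, ⟨φ⟩⟩ := AddCommGroup.equiv_directSum_zmod_of_finite' A
  have φ' := φ.trans (DirectSum.addEquivProd _)
  have hprod : ∏ i, d i = q ^ n := by
    rw [← hA, Nat.card_congr φ'.toEquiv, Nat.card_pi]
    simp
  have hpow : ∀ i, ∃ a, d i = q ^ a := fun i => by
    obtain ⟨a, -, ha⟩ := (Nat.dvd_prime_pow hq.out).1
      (hprod ▸ Finset.dvd_prod_of_mem d (Finset.mem_univ i))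
    exact ⟨a, ha⟩
  choose e he using hpow
  obtain rfl : d = fun i => q ^ e i := funext he
  refine ⟨ι, inferInstance, e, fun i => ?_, ⟨φ'⟩⟩
  by_contra h
  have h1 := hd i
  simp [show e i = 0 by omega] at h1

lemma exists_iso_model (P : PtdAbGroup) {n : ℕ} (hP : Nat.card P.carrier = q ^ n) :
    ∃ (k : ℕ) (e m : Fin k → ℕ) (l : List (Fin k × ℕ)), StrictMono e ∧ (∀ i, 1 ≤ e i) ∧
      (∀ i, 0 < m i) ∧ ∑ i, m i * e i = n ∧ l ∈ GalkinI k e ∧ (model q e m l).Iso P := by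
  obtain ⟨ι, _, e, he1, ⟨φ⟩⟩ := exists_addEquiv_pi_zmod P.carrier hP
  obtain ⟨Φ, S, hΦ, hS⟩ := exists_addEquiv_eq_elem e (φ P.pt)
  obtain ⟨Ψ, T, hΨ, hT, hanti⟩ := exists_addEquiv_elem_eq_elem_antichain (q := q) e S hS
  obtain ⟨k, e', m, σ, he', hm, hee', hσ⟩ := exists_equiv_sigma_fin e {p | T p ≠ none} (by
    intro i hi j hj hij
    by_contra hne
    obtain ⟨f, hf⟩ := Option.ne_none_iff_exists'.1 hi
    obtain ⟨g, hg⟩ := Option.ne_none_iff_exists'.1 hj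
    have h1 := hanti i j f g hne hf hg
    have h2 := hanti j i g f (Ne.symm hne) hg hf
    omega)
  let b : ∀ i : Fin k, ι := fun i => σ.symm ⟨i, ⟨0, hm i⟩⟩
  have hb : ∀ i, e (b i) = e' i := fun i => by simp [hee', b]
  have hb_inj : Function.Injective b := fun i j hij => by
    have := congrArg Sigma.fst (σ.symm.injective hij)
    exact this
  obtain ⟨l, hl, hlT⟩ := exists_mem_galkinI he' (fun i => T (b i))
    (fun i f hf => hb i ▸ hT _ _ hf) (fun i j f g hij hf hg => by
      rw [← hb, ← hb]
      exact hanti _ _ f g (hb_inj.ne hij) hf hg)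
  have hsupp : T = sigmaSupport m (listOpt l) ∘ σ := by
    funext p
    simp only [Function.comp, sigmaSupport, hlT]
    split_ifs with h
    · have : (⟨(σ p).1, ⟨0, hm _⟩⟩ : Σ i, Fin (m i)) = σ p :=
        Sigma.ext rfl (heq_of_eq (Fin.ext h.symm))
      simp only [b]
      rw [this, σ.symm_apply_apply]
    · by_contra hp
      exact h (hσ p hp)
  obtain ⟨Θ, hΘ⟩ := exists_addEquiv_elem_reindex (q := q) σ e (fun s => e' s.1) hee'
    (sigmaSupport m (listOpt l))
  have hiso : (model q e' m l).Iso P := iso_equivalence_s8.symm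
    ⟨((φ.trans Φ).trans Ψ).trans Θ, by
      change Θ (Ψ (Φ (φ P.pt))) = _
      rw [hΦ, hΨ, hsupp, hΘ]
      rfl⟩
  refine ⟨k, e', m, l, he', fun i => hb i ▸ he1 _, hm, ?_, hl, hiso⟩
  obtain ⟨f, -⟩ := hiso
  apply Nat.pow_right_injective hq.out.two_le
  change q ^ _ = q ^ _
  rw [← card_model e' m l, ← hP]
  exact Nat.card_congr f.toEquiv

end Model

end PtdAbGroup

/-- The number of isomorphism classes of pointed abelian groups of order `q ^ n` equals
the sum of `|I(e₁,…,e_k)|` over all `1 ≤ e₁ < ⋯ < e_k`, `n₁, …, n_k > 0` with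
`n₁e₁ + ⋯ + n_ke_k = n` (the sum being realized as the cardinality of the corresponding
disjoint union). -/
theorem card_ptdAbGroup_classes_eq_sum_card_GalkinI (q : ℕ) (hq : q.Prime) (n : ℕ) :
    Nat.card (Quot (fun P Q : {P : PtdAbGroup // Nat.card P.carrier = q ^ n} =>
        PtdAbGroup.Iso P.1 Q.1)) =
      Nat.card (Σ (k : ℕ)
        (em : {em : (Fin k → ℕ) × (Fin k → ℕ) // StrictMono em.1 ∧ (∀ i, 1 ≤ em.1 i) ∧
          (∀ i, 0 < em.2 i) ∧ ∑ i, em.2 i * em.1 i = n}),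
        GalkinI k em.1.1) := by
  have : Fact q.Prime := ⟨hq⟩
  symm
  refine Nat.card_eq_of_bijective (fun x => Quot.mk _
    ⟨PtdAbGroup.model q x.2.1.1.1 x.2.1.1.2 x.2.2.1,
      (PtdAbGroup.card_model _ _ _).trans (by rw [x.2.1.2.2.2.2])⟩) ⟨?_, ?_⟩
  · rintro ⟨k, ⟨⟨e, m⟩, he, he1, hm, hn⟩, l, hl⟩ ⟨k', ⟨⟨e', m'⟩, he', he1', hm', hn'⟩, l', hl'⟩ h
    have hiso := ((PtdAbGroup.iso_equivalence_s8.comap Subtype.val).quot_mk_eq_iff _ _).1 h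
    obtain ⟨rfl, rfl, rfl⟩ := PtdAbGroup.eq_of_model_iso he he' he1 he1' hm hm' hiso
    obtain rfl := PtdAbGroup.list_eq_of_model_iso he hm hl hl' hiso
    rfl
  · rintro ⟨⟨P, hP⟩⟩
    obtain ⟨k, e, m, l, he, he1, hm, hn, hl, hiso⟩ := PtdAbGroup.exists_iso_model P hP
    exact ⟨⟨k, ⟨⟨e, m⟩, he, he1, hm, hn⟩, l, hl⟩, Quot.sound hiso⟩
end

section
/- Let A be an abelian group and c ∈ A. Define μ, τ : ℤ/3ℤ → ℤ by μ(0)=2, μ(x)=-1 for x≠0, and τ(2)=1, τ(x)=0 for x≠2, and define on ℤ/3ℤ × A the operation (x,a)*(y,b) = (-x-y, -a + μ(x-y)b + τ(x-y)c). Then (ℤ/3ℤ × A, *) is a quandle: (i) z*z = z for all z; (ii) for each w, the map z ↦ z*w is a bijection of ℤ/3ℤ × A; (iii) (z*w)*v = (z*v)*(w*v) for all z, w, v. -/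
/-- `μ : ℤ/3ℤ → ℤ`, `μ(0) = 2`, `μ(x) = -1` for `x ≠ 0`. -/
def galkinMu (x : ZMod 3) : ℤ := if x = 0 then 2 else -1

/-- `τ : ℤ/3ℤ → ℤ`, `τ(2) = 1`, `τ(x) = 0` for `x ≠ 2`. -/
def galkinTau (x : ZMod 3) : ℤ := if x = 2 then 1 else 0

/-- The Galkin operation on `ℤ/3ℤ × A` associated to a pointed abelian group `(A, c)`:
`(x,a) * (y,b) = (-x-y, -a + μ(x-y)b + τ(x-y)c)`. -/
def galkinOp {A : Type*} [AddCommGroup A] (c : A) (z w : ZMod 3 × A) : ZMod 3 × A :=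
  (-z.1 - w.1, -z.2 + galkinMu (z.1 - w.1) • w.2 + galkinTau (z.1 - w.1) • c)

theorem galkinMu_neg (x : ZMod 3) : galkinMu (-x) = galkinMu x := by
  simp [galkinMu]

theorem galkinMu_mul (x y u : ZMod 3) :
    galkinMu (y - x) * galkinMu (y - u) = galkinMu (-x - y - u) + galkinMu (x - u) := by
  revert x y u; decide

theorem galkinTau_cocycle (x y u : ZMod 3) :
    -galkinTau (x - y) + galkinTau (-x - y - u) =
      -galkinTau (x - u) + galkinMu (y - x) * galkinTau (y - u) + galkinTau (y - x) := by
  revert x y u; decide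

theorem neg_sub_sub_eq_sub (x y : ZMod 3) : -x - y - y = y - x := by
  revert x y; decide

theorem galkinOp_self {A : Type*} [AddCommGroup A] (c : A) (z : ZMod 3 × A) :
    galkinOp c z z = z := by
  obtain ⟨x, a⟩ := z
  have hx : -x - x = x := by revert x; decide
  have hτ : galkinTau 0 = 0 := by decide
  have hμ : galkinMu 0 = 2 := by decide
  simp only [galkinOp, sub_self, hx, hτ, hμ]
  congr 1
  module

theorem galkinOp_bijective {A : Type*} [AddCommGroup A] (c : A) (w : ZMod 3 × A) :
    Function.Bijective fun z => galkinOp c z w := by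
  obtain ⟨y, b⟩ := w
  refine Function.bijective_iff_has_inverse.mpr
    ⟨fun z => (-z.1 - y, -z.2 + galkinMu (y - z.1) • b + galkinTau (y - z.1) • c), ?_, ?_⟩
  · rintro ⟨x, a⟩
    have h : y - (-x - y) = x - y := by revert x y; decide
    simp only [galkinOp, h]
    ext
    · simp
    · simp only; module
  · rintro ⟨x, a⟩
    simp only [galkinOp, neg_sub_sub_eq_sub]
    ext
    · simp
    · simp only; module

theorem galkinOp_right_distrib {A : Type*} [AddCommGroup A] (c : A) (z w v : ZMod 3 × A) :
    galkinOp c (galkinOp c z w) v = galkinOp c (galkinOp c z v) (galkinOp c w v) := by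
  obtain ⟨x, a⟩ := z
  obtain ⟨y, b⟩ := w
  obtain ⟨u, d⟩ := v
  have h₁ : -(-x - y) - u = -(-x - u) - (-y - u) := by revert x y u; decide
  have h₂ : -x - u - (-y - u) = y - x := by ring
  have hμ : galkinMu (x - y) = galkinMu (y - x) := by rw [← galkinMu_neg, neg_sub]
  have hd : galkinMu (-x - y - u) =
      galkinMu (y - x) * galkinMu (y - u) - galkinMu (x - u) := by
    rw [galkinMu_mul]; ring
  have hc : galkinTau (-x - y - u) = galkinTau (x - y) - galkinTau (x - u) +
      galkinMu (y - x) * galkinTau (y - u) + galkinTau (y - x) := by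
    linarith [galkinTau_cocycle x y u]
  simp only [galkinOp, h₁, h₂, hμ, hd, hc]
  congr 1
  module

/-- The Galkin quandle `G(A,c)`: `(ℤ/3ℤ × A, *)` satisfies the three quandle axioms. -/
theorem galkinOp_isQuandle {A : Type*} [AddCommGroup A] (c : A) :
    (∀ z : ZMod 3 × A, galkinOp c z z = z) ∧
    (∀ w : ZMod 3 × A, Function.Bijective fun z => galkinOp c z w) ∧
    (∀ z w v : ZMod 3 × A,
      galkinOp c (galkinOp c z w) v = galkinOp c (galkinOp c z v) (galkinOp c w v)) := by
  exact ⟨galkinOp_self c, galkinOp_bijective c, galkinOp_right_distrib c⟩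
end
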